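/- arXiv:1103.5809 — 4 statements merged into one kernel-verified Lean document; each statement's English description precedes it below -/
import Mathlib

section
/- Let K be a field of characteristic 0 and let I be a proper homogeneous ideal of the polynomial ring R = K[x_0,...,x_N]. Then the second symbolic power I^(2) is contained in M·I, where M = (x_0,...,x_N) is the irrelevant maximal ideal. -/
open MvPolynomial
open scoped LinearAlgebra.Projectivization

noncomputable section

/-- The `m`-th symbolic power of an ideal `I`:
`I⁽ᵐ⁾ = R ∩ (⋂_{P ∈ Ass(R/I)} (Iᵐ)_P)`, described elementwise. -/
def symbolicPower {R : Type*} [CommRing R] (I : Ideal R) (m : ℕ) : Ideal R where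
  carrier := {x | ∀ P ∈ associatedPrimes R (R ⧸ I), ∃ s ∉ P, s * x ∈ I ^ m}
  zero_mem' := by
    intro P hP
    refine ⟨1, fun h => hP.isPrime.ne_top (Ideal.eq_top_of_isUnit_mem _ h isUnit_one), ?_⟩
    simp
  add_mem' := by
    intro x y hx hy P hP
    obtain ⟨s, hs, hsx⟩ := hx P hP
    obtain ⟨t, ht, hty⟩ := hy P hP
    refine ⟨s * t, fun h => ?_, ?_⟩
    · rcases hP.isPrime.mem_or_mem h with h' | h'
      exacts [hs h', ht h']
    · have heq : s * t * (x + y) = t * (s * x) + s * (t * y) := by ring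
      rw [heq]
      exact add_mem (Ideal.mul_mem_left _ _ hsx) (Ideal.mul_mem_left _ _ hty)
  smul_mem' := by
    intro c x hx P hP
    obtain ⟨s, hs, hsx⟩ := hx P hP
    refine ⟨s, hs, ?_⟩
    have heq : s * (c • x) = c * (s * x) := by
      simp only [smul_eq_mul]; ring
    rw [heq]
    exact Ideal.mul_mem_left _ _ hsx

/-- An ideal of a polynomial ring is homogeneous if it contains every homogeneous
component of each of its members. -/
def IsHomogeneousIdeal {σ K : Type*} [CommSemiring K]
    (I : Ideal (MvPolynomial σ K)) : Prop :=
  ∀ f ∈ I, ∀ d : ℕ, MvPolynomial.homogeneousComponent d f ∈ I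

/-- The irrelevant maximal ideal `M = (x_0, …, x_N)` of `K[x_0, …, x_N]`. -/
def irrIdeal (K : Type*) [Field K] (N : ℕ) : Ideal (MvPolynomial (Fin (N + 1)) K) :=
  Ideal.span (Set.range MvPolynomial.X)

/-- Over a Noetherian ring, `I` contains `x` as soon as each associated prime of `I` fails to
contain some multiplier of `x` into `I`. -/
theorem mem_of_forall_associatedPrimes {R : Type*} [CommRing R] [IsNoetherianRing R]
    {I : Ideal R} {x : R} (h : ∀ P ∈ associatedPrimes R (R ⧸ I), ∃ s ∉ P, s * x ∈ I) : x ∈ I := by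
  by_contra hx
  obtain ⟨P, hP, hle⟩ := exists_le_isAssociatedPrime_of_isNoetherianRing R
    (Ideal.Quotient.mk I x) (mt Ideal.Quotient.eq_zero_iff_mem.mp hx)
  obtain ⟨s, hs, hsx⟩ := h P hP
  refine hs (hle (Submodule.mem_colon_singleton.mpr ?_))
  rw [Submodule.mem_bot, Algebra.smul_def]
  exact Ideal.Quotient.eq_zero_iff_mem.mpr hsx

theorem symbolicPower_le {R : Type*} [CommRing R] [IsNoetherianRing R] (I : Ideal R) {m : ℕ}
    (hm : m ≠ 0) : symbolicPower I m ≤ I := fun _ hx =>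
  mem_of_forall_associatedPrimes fun P hP =>
    let ⟨s, hs, hsx⟩ := hx P hP
    ⟨s, hs, Ideal.pow_le_self hm hsx⟩

/-- A derivation maps the square of an ideal into the ideal. -/
theorem Derivation.apply_mem_of_mem_sq {A R : Type*} [CommRing A] [CommRing R] [Algebra A R]
    (D : Derivation A R R) {I : Ideal R} {x : R} (hx : x ∈ I ^ 2) : D x ∈ I := by
  rw [pow_two] at hx
  induction hx using Submodule.mul_induction_on' with
  | mem_mul_mem a ha b hb =>
    rw [D.leibniz]
    exact add_mem (I.mul_mem_right _ ha) (I.mul_mem_right _ hb)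
  | add a _ b _ ha hb =>
    rw [map_add]
    exact add_mem ha hb

/-- A derivation maps the second symbolic power of an ideal into the ideal. -/
theorem Derivation.apply_mem_of_mem_symbolicPower_two {A R : Type*} [CommRing A] [CommRing R]
    [Algebra A R] [IsNoetherianRing R] (D : Derivation A R R) {I : Ideal R} {x : R}
    (hx : x ∈ symbolicPower I 2) : D x ∈ I := by
  refine mem_of_forall_associatedPrimes fun P hP => ?_
  obtain ⟨s, hs, hsx⟩ := hx P hP
  refine ⟨s, hs, ?_⟩
  have hD := D.apply_mem_of_mem_sq hsx
  rw [D.leibniz, smul_eq_mul, smul_eq_mul] at hD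
  exact (I.add_mem_iff_left (I.mul_mem_right _ (symbolicPower_le I two_ne_zero hx))).mp hD

theorem MvPolynomial.pderiv_homogeneousComponent_succ {σ R : Type*} [CommSemiring R] (i : σ)
    (d : ℕ) (f : MvPolynomial σ R) :
    pderiv i (homogeneousComponent (d + 1) f) = homogeneousComponent d (pderiv i f) := by
  induction f using MvPolynomial.induction_on' with
  | add p q hp hq => simp only [map_add, hp, hq]
  | monomial u a =>
    have hu : (monomial u a).IsHomogeneous u.degree := isHomogeneous_monomial a rfl
    rw [homogeneousComponent_of_mem hu]
    by_cases h0 : u.degree = 0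
    · have hu0 : u = 0 := (Finsupp.degree_eq_zero_iff u).mp h0
      subst hu0
      simp
    · rw [homogeneousComponent_of_mem hu.pderiv]
      by_cases h : d + 1 = u.degree
      · rw [if_pos h, if_pos (by omega)]
      · rw [if_neg h, if_neg (by omega), map_zero]

/-- If `char K = 0` and `I` is a proper homogeneous ideal of
`K[x_0,…,x_N]`, then `I^(2) ⊆ M·I`. -/
theorem symbolic_square_subset_max_mul {K : Type*} [Field K] [CharZero K] {N : ℕ}
    (I : Ideal (MvPolynomial (Fin (N + 1)) K)) (hproper : I ≠ ⊤)
    (hhom : IsHomogeneousIdeal I) :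
    symbolicPower I 2 ≤ irrIdeal K N * I := by
  intro f hf
  rw [← sum_homogeneousComponent f]
  refine sum_mem fun d _ => ?_
  obtain _ | d := d
  · have hC := hhom f (symbolicPower_le I two_ne_zero hf) 0
    rw [homogeneousComponent_zero] at hC ⊢
    by_cases h : coeff 0 f = 0
    · simp [h]
    · exact absurd (I.eq_top_of_isUnit_mem hC ((isUnit_iff_ne_zero.mpr h).map C)) hproper
  · have hEuler := (homogeneousComponent_isHomogeneous (d + 1) f).sum_X_mul_pderiv
    have hmem : (d + 1) • homogeneousComponent (d + 1) f ∈ irrIdeal K N * I := by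
      rw [← hEuler]
      refine sum_mem fun i _ => Ideal.mul_mem_mul (Ideal.subset_span ⟨i, rfl⟩) ?_
      rw [pderiv_homogeneousComponent_succ]
      exact hhom _ ((pderiv i).apply_mem_of_mem_symbolicPower_two hf) d
    have hd : ((d + 1 : ℕ) : K) ≠ 0 := Nat.cast_ne_zero.mpr d.succ_ne_zero
    rw [← Nat.cast_smul_eq_nsmul K] at hmem
    have hinv := Submodule.smul_of_tower_mem _ ((d + 1 : ℕ) : K)⁻¹ hmem
    rwa [inv_smul_smul₀ hd] at hinv

end
end

section
/- Let K be a field and let I be a nonzero proper homogeneous ideal of R = K[x_0,...,x_N]. Then for every m > 0, α(I^(m))/m ≥ α(I)/N, where α(J) denotes the least degree of a nonzero form in a homogeneous ideal J. -/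
open MvPolynomial
open scoped LinearAlgebra.Projectivization

noncomputable section

/-- `α(J)`: the least degree of a nonzero form in `J`. -/
def alphaDeg {σ K : Type*} [CommSemiring K] (J : Ideal (MvPolynomial σ K)) : ℕ :=
  sInf {d : ℕ | ∃ f ∈ J, f ≠ 0 ∧ MvPolynomial.IsHomogeneous f d}


section Reduction

variable {R : Type*} [CommRing R]

lemma span_singleton_pow_mul_pow_le {c : R} {I J : Ideal R} {l : ℕ} (hJ : J ≤ I)
    (h : Ideal.span {c} * I ^ (l + 1) ≤ J * I ^ l + I ^ (l + 2)) (n : ℕ) :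
    Ideal.span {c} ^ n * I ^ (l + n) ≤ J ^ n * I ^ l + I ^ (l + n + 1) := by
  induction n with
  | zero => simp
  | succ n ih =>
    calc Ideal.span {c} ^ (n + 1) * I ^ (l + (n + 1))
        = Ideal.span {c} * I * (Ideal.span {c} ^ n * I ^ (l + n)) := by ring
      _ ≤ Ideal.span {c} * I * (J ^ n * I ^ l + I ^ (l + n + 1)) := by gcongr
      _ = J ^ n * (Ideal.span {c} * I ^ (l + 1)) + Ideal.span {c} * I ^ (l + (n + 1) + 1) := by
          ring
      _ ≤ J ^ n * (J * I ^ l + I ^ (l + 2)) + I ^ (l + (n + 1) + 1) := by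
          gcongr
          exact Ideal.mul_le_right
      _ = J ^ (n + 1) * I ^ l + (J ^ n * I ^ (l + 2) + I ^ (l + (n + 1) + 1)) := by ring
      _ ≤ J ^ (n + 1) * I ^ l + (I ^ n * I ^ (l + 2) + I ^ (l + (n + 1) + 1)) := by gcongr
      _ = J ^ (n + 1) * I ^ l + I ^ (l + (n + 1) + 1) := by
          rw [← pow_add, show n + (l + 2) = l + (n + 1) + 1 by ring, add_idem]

lemma reduction_trans {c₁ c₂ : R} {I J J' : Ideal R} {l₁ l₂ : ℕ} (hJ : J ≤ I)
    (h₁ : Ideal.span {c₁} * I ^ (l₁ + 1) ≤ J * I ^ l₁ + I ^ (l₁ + 2))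
    (h₂ : Ideal.span {c₂} * J ^ (l₂ + 1) ≤ J' * I ^ l₂ + I ^ (l₂ + 2)) :
    Ideal.span {c₂ * c₁ ^ (l₂ + 1)} * I ^ (l₁ + l₂ + 1) ≤
      J' * I ^ (l₁ + l₂) + I ^ (l₁ + l₂ + 2) := by
  rw [← Ideal.span_singleton_mul_span_singleton, ← Ideal.span_singleton_pow]
  calc Ideal.span {c₂} * Ideal.span {c₁} ^ (l₂ + 1) * I ^ (l₁ + l₂ + 1)
      = Ideal.span {c₂} * (Ideal.span {c₁} ^ (l₂ + 1) * I ^ (l₁ + (l₂ + 1))) := by ring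
    _ ≤ Ideal.span {c₂} * (J ^ (l₂ + 1) * I ^ l₁ + I ^ (l₁ + (l₂ + 1) + 1)) := by
        gcongr
        exact span_singleton_pow_mul_pow_le hJ h₁ _
    _ = Ideal.span {c₂} * J ^ (l₂ + 1) * I ^ l₁ + Ideal.span {c₂} * I ^ (l₁ + l₂ + 2) := by ring
    _ ≤ (J' * I ^ l₂ + I ^ (l₂ + 2)) * I ^ l₁ + I ^ (l₁ + l₂ + 2) := by
        gcongr
        exact Ideal.mul_le_right
    _ = J' * I ^ (l₁ + l₂) + (I ^ (l₁ + l₂ + 2) + I ^ (l₁ + l₂ + 2)) := by ring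
    _ = _ := by rw [add_idem]

lemma span_singleton_pow_mul_le {c : R} {I J Q : Ideal R} {l n M : ℕ}
    (h : Ideal.span {c} * I ^ (l + 1) ≤ J * I ^ l + I ^ (l + 2)) (hJ : J ≤ I)
    (hJQ : J ^ n ≤ Q) (hIQ : I ^ M ≤ Q) (k i w : ℕ) (hw : n + l ≤ i + w)
    (hk : n + M ≤ k + i + (i + w)) :
    Ideal.span {c} ^ k * (J ^ i * I ^ w) ≤ Q := by
  induction k generalizing i w with
  | zero =>
    rw [pow_zero, one_mul]
    by_cases hi : n ≤ i
    · exact Ideal.mul_le_left.trans ((Ideal.pow_le_pow_right hi).trans hJQ)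
    · calc J ^ i * I ^ w ≤ I ^ i * I ^ w := by gcongr
        _ = I ^ (i + w) := (pow_add ..).symm
        _ ≤ Q := (Ideal.pow_le_pow_right (by omega)).trans hIQ
  | succ k ih =>
    by_cases hi : n ≤ i
    · exact Ideal.mul_le_right.trans
        (Ideal.mul_le_left.trans ((Ideal.pow_le_pow_right hi).trans hJQ))
    · obtain ⟨w', rfl⟩ : ∃ w', w = w' + (l + 1) := ⟨w - (l + 1), by omega⟩
      calc Ideal.span {c} ^ (k + 1) * (J ^ i * I ^ (w' + (l + 1)))
          = Ideal.span {c} ^ k * (J ^ i * I ^ w' * (Ideal.span {c} * I ^ (l + 1))) := by ring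
        _ ≤ Ideal.span {c} ^ k * (J ^ i * I ^ w' * (J * I ^ l + I ^ (l + 2))) := by gcongr
        _ = Ideal.span {c} ^ k * (J ^ (i + 1) * I ^ (w' + l)) +
            Ideal.span {c} ^ k * (J ^ i * I ^ (w' + l + 2)) := by ring
        _ ≤ Q := sup_le (ih _ _ (by omega) (by omega)) (ih _ _ (by omega) (by omega))

lemma span_range_pow_le {Q : Ideal R} {q s : ℕ} (g : Fin s → R) (hg : ∀ i, g i ^ q ∈ Q) :
    Ideal.span (Set.range g) ^ (s * q + 1) ≤ Q := by
  induction s with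
  | zero => simp [Set.range_eq_empty]
  | succ s ih =>
    rw [← Fin.cons_self_tail g, Fin.range_cons, Ideal.span_insert,
      show (s + 1) * q + 1 = q + (s * q + 1) by ring]
    refine Ideal.sup_pow_add_le_pow_sup_pow.trans (sup_le ?_ (ih _ fun i => hg _))
    rw [Ideal.span_singleton_pow, Ideal.span_singleton_le_iff_mem]
    exact hg 0

lemma mul_prod_sub_prod_mem {ι : Type*} {I J : Ideal R} (x y : ι → R)
    (hx : ∀ i, x i ∈ I) (hy : ∀ i, y i ∈ I) (hxy : ∀ i, x i - y i ∈ J) (t : Multiset ι)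
    {w : R} (hw : w ∈ I) :
    w * ((t.map x).prod - (t.map y).prod) ∈ J * I ^ t.card := by
  induction t using Multiset.induction_on with
  | empty => simp
  | cons a t ih =>
    have hX : (t.map x).prod ∈ I ^ t.card := by
      clear ih
      induction t using Multiset.induction_on with
      | empty => simp
      | cons b t ih => simpa [pow_succ'] using Ideal.mul_mem_mul (hx b) ih
    simp only [Multiset.map_cons, Multiset.prod_cons, Multiset.card_cons]
    have : w * (x a * (t.map x).prod - y a * (t.map y).prod) =
        (x a - y a) * (w * (t.map x).prod) + y a * (w * ((t.map x).prod - (t.map y).prod)) := by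
      ring
    rw [this]
    refine add_mem (Ideal.mul_mem_mul (hxy a) ?_) ?_
    · rw [pow_succ']
      exact Ideal.mul_mem_mul hw hX
    · rw [pow_succ', mul_left_comm]
      exact Ideal.mul_mem_mul (hy a) ih

end Reduction

lemma sup_pow_succ_le {R : Type*} [CommRing R] {I J W : Ideal R} (hJ : J ≤ I) (hW : W ≤ I)
    (n : ℕ) : (J + W) ^ (n + 1) ≤ J * I ^ n + W ^ (n + 1) := by
  induction n with
  | zero => simp
  | succ n ih =>
    calc (J + W) ^ (n + 1 + 1) = J * (J + W) ^ (n + 1) + W * (J + W) ^ (n + 1) := by ring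
      _ ≤ J * (I + I) ^ (n + 1) + I * (J * I ^ n) + W * W ^ (n + 1) := by
        rw [add_assoc]
        refine add_le_add (by gcongr) ((Ideal.mul_mono_right ih).trans ?_)
        rw [mul_add]
        gcongr
      _ = J * I ^ (n + 1) + W ^ (n + 1 + 1) := by
        rw [add_idem, mul_left_comm, ← pow_succ' I, add_idem, pow_succ' W (n + 1)]

section AlgebraicDependence

variable {C R : Type*} [CommRing C] [CommRing R] [Algebra C R]

lemma aeval_eq_sum_toMultiset {σ : Type*} (x : σ → R) (G : MvPolynomial σ C) :
    MvPolynomial.aeval x G =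
      ∑ d ∈ G.support, algebraMap C R (G.coeff d) * (d.toMultiset.map x).prod := by
  rw [MvPolynomial.aeval_def, MvPolynomial.eval₂_eq]
  refine Finset.sum_congr rfl fun d _ => ?_
  rw [Finsupp.toMultiset_map, Finsupp.prod_toMultiset, Finsupp.prod_mapDomain_index]
  · rfl
  · simp
  · simp [pow_add]

lemma card_toMultiset_of_mem_support {σ : Type*} {G : MvPolynomial σ C} {l : ℕ}
    (hG : G.IsHomogeneous l) {d : σ →₀ ℕ} (hd : d ∈ G.support) : d.toMultiset.card = l := by
  rw [Finsupp.card_toMultiset, hG.degree_eq_sum_deg_support hd]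
  rfl

lemma aeval_mem_pow {σ : Type*} {I : Ideal R} {x : σ → R} (hx : ∀ i, x i ∈ I)
    {G : MvPolynomial σ C} {l : ℕ} (hG : G.IsHomogeneous l) :
    MvPolynomial.aeval x G ∈ I ^ l := by
  rw [aeval_eq_sum_toMultiset]
  refine sum_mem fun d hd => Ideal.mul_mem_left _ _ ?_
  rw [← card_toMultiset_of_mem_support hG hd]
  generalize d.toMultiset = t
  induction t using Multiset.induction_on with
  | empty => simp
  | cons b t ih => simpa [pow_succ'] using Ideal.mul_mem_mul (hx b) ih

lemma mul_aeval_sub_aeval_mem {σ : Type*} {I J : Ideal R} (x y : σ → R)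
    (hx : ∀ i, x i ∈ I) (hy : ∀ i, y i ∈ I) (hxy : ∀ i, x i - y i ∈ J)
    {G : MvPolynomial σ C} {l : ℕ} (hG : G.IsHomogeneous l) {w : R} (hw : w ∈ I) :
    w * (MvPolynomial.aeval x G - MvPolynomial.aeval y G) ∈ J * I ^ l := by
  rw [aeval_eq_sum_toMultiset, aeval_eq_sum_toMultiset, ← Finset.sum_sub_distrib, Finset.mul_sum]
  refine sum_mem fun d hd => ?_
  rw [← mul_sub, mul_left_comm, ← card_toMultiset_of_mem_support hG hd]
  exact Ideal.mul_mem_left _ _ (mul_prod_sub_prod_mem x y hx hy hxy _ hw)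

lemma aeval_mul_right {σ : Type*} (a : σ → R) (w : R)
    {G : MvPolynomial σ C} {l : ℕ} (hG : G.IsHomogeneous l) :
    MvPolynomial.aeval (fun i => a i * w) G = MvPolynomial.aeval a G * w ^ l := by
  rw [aeval_eq_sum_toMultiset, aeval_eq_sum_toMultiset, Finset.sum_mul]
  refine Finset.sum_congr rfl fun d hd => ?_
  rw [← card_toMultiset_of_mem_support hG hd, Multiset.prod_map_mul]
  simp [mul_assoc]

lemma exists_isHomogeneous_aeval_mem {σ : Type*} {I : Ideal R} {x : σ → R} (hx : ∀ i, x i ∈ I)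
    {H : MvPolynomial σ C} (hH : H ≠ 0) (h : MvPolynomial.aeval x H = 0) :
    ∃ (l : ℕ) (G : MvPolynomial σ C), G ≠ 0 ∧ G.IsHomogeneous l ∧
      MvPolynomial.aeval x G ∈ I ^ (l + 1) := by
  classical
  have hex : ∃ l, MvPolynomial.homogeneousComponent l H ≠ 0 := by
    by_contra! hall
    exact hH (by rw [← MvPolynomial.sum_homogeneousComponent H]; simp [hall])
  refine ⟨Nat.find hex, _, Nat.find_spec hex,
    MvPolynomial.homogeneousComponent_isHomogeneous _ _, ?_⟩
  have hlt : Nat.find hex ∈ Finset.range (H.totalDegree + 1) := by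
    by_contra hn
    exact Nat.find_spec hex (MvPolynomial.homogeneousComponent_eq_zero _ _ (by simpa using hn))
  have hsum := h
  rw [← MvPolynomial.sum_homogeneousComponent H, map_sum,
    ← Finset.add_sum_erase _ _ hlt] at hsum
  rw [eq_neg_of_add_eq_zero_left hsum]
  refine neg_mem (sum_mem fun i hi => ?_)
  rcases lt_or_ge i (Nat.find hex) with hi' | hi'
  · have := Nat.find_min hex hi'
    rw [not_not] at this
    simp [this]
  · have : Nat.find hex ≠ i := (Finset.ne_of_mem_erase hi).symm
    exact Ideal.pow_le_pow_right (by omega)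
      (aeval_mem_pow hx (MvPolynomial.homogeneousComponent_isHomogeneous i H))

variable [IsDomain C] [Infinite C]

lemma exists_reduction_of_aeval_eq_zero {s : ℕ} {I : Ideal R} {g : Fin (s + 1) → R}
    (hg : ∀ i, g i ∈ I) {H : MvPolynomial (Fin (s + 1)) C} (hH : H ≠ 0)
    (h : MvPolynomial.aeval g H = 0) :
    ∃ (c : C) (g' : Fin s → R) (l : ℕ), c ≠ 0 ∧ (∀ i, g' i ∈ I) ∧
      Ideal.span {algebraMap C R c} * Ideal.span (Set.range g) ^ (l + 1) ≤
        Ideal.span (Set.range g') * I ^ l + I ^ (l + 2) := by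
  obtain ⟨l, G, hG0, hG, hGI⟩ := exists_isHomogeneous_aeval_mem hg hH h
  obtain ⟨a, ha⟩ : ∃ a, MvPolynomial.eval a (G * MvPolynomial.X (Fin.last s)) ≠ 0 := by
    by_contra! hall
    refine mul_ne_zero hG0 (MvPolynomial.X_ne_zero (Fin.last s))
      (MvPolynomial.funext fun a => ?_)
    simpa using hall a
  rw [map_mul, MvPolynomial.eval_X] at ha
  set b := a (Fin.last s) with hb
  set w := g (Fin.last s) with hw
  let A := algebraMap C R
  let g' : Fin s → R := fun i => A b * g i.castSucc - A (a i.castSucc) * w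
  let J := Ideal.span (Set.range g')
  have hdiff : ∀ i, g i * A b - A (a i) * w ∈ J := by
    intro i
    induction i using Fin.lastCases with
    | last => rw [← hw, ← hb, mul_comm, sub_self]; exact zero_mem _
    | cast i => exact Ideal.subset_span ⟨i, by simp only [g']; ring⟩
  have hgJ : Ideal.span {A b} * Ideal.span (Set.range g) ≤ J + Ideal.span {w} := by
    rw [Ideal.span_mul_span', Ideal.span_le]
    rintro _ ⟨_, rfl, _, ⟨i, rfl⟩, rfl⟩
    have : A b * g i = (g i * A b - A (a i) * w) + A (a i) * w := by ring
    simp only [SetLike.mem_coe, this]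
    exact Submodule.add_mem_sup (hdiff i)
      (Ideal.mul_mem_left _ _ (Ideal.mem_span_singleton_self w))
  have hgI : Ideal.span (Set.range g) ≤ I := Ideal.span_le.2 (Set.range_subset_iff.2 hg)
  have hJI : J ≤ I := Ideal.span_le.2 (Set.range_subset_iff.2 fun i =>
    sub_mem (I.mul_mem_left _ (hg _)) (I.mul_mem_left _ (hg _)))
  have hwJ : A (MvPolynomial.eval a G) * w ^ (l + 1) ∈ J * I ^ l + I ^ (l + 2) := by
    have h1 := mul_aeval_sub_aeval_mem (fun i => g i * A b) (fun i => A (a i) * w)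
      (fun i => I.mul_mem_right _ (hg i)) (fun i => I.mul_mem_left _ (hg _)) hdiff hG
      (hg (Fin.last s))
    rw [aeval_mul_right _ _ hG, aeval_mul_right _ _ hG] at h1
    have h2 : MvPolynomial.aeval (fun i => A (a i)) G = A (MvPolynomial.eval a G) := by
      rw [← MvPolynomial.coe_aeval_eq_eval]
      exact MvPolynomial.aeval_algebraMap_apply R a G
    rw [h2] at h1
    have h3 : A (MvPolynomial.eval a G) * w ^ (l + 1) =
        -(g (Fin.last s) * (MvPolynomial.aeval g G * A b ^ l -
          A (MvPolynomial.eval a G) * w ^ l)) +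
        A b ^ l * (w * MvPolynomial.aeval g G) := by
      rw [← hw]; ring
    rw [h3]
    refine Submodule.add_mem_sup (neg_mem h1) (Ideal.mul_mem_left _ _ ?_)
    rw [show l + 2 = (l + 1) + 1 by rfl, pow_succ' I (l + 1)]
    exact Ideal.mul_mem_mul (hg _) hGI
  refine ⟨MvPolynomial.eval a G * b ^ (l + 1), g', l,
    mul_ne_zero (left_ne_zero_of_mul ha) (pow_ne_zero _ (right_ne_zero_of_mul ha)),
    fun i => hJI (Ideal.subset_span ⟨i, rfl⟩), ?_⟩
  change Ideal.span {A _} * _ ≤ J * I ^ l + I ^ (l + 2)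
  rw [map_mul, map_pow, ← Ideal.span_singleton_mul_span_singleton, ← Ideal.span_singleton_pow,
    mul_assoc, ← mul_pow]
  have hJw : (J + Ideal.span {w}) ^ (l + 1) ≤ J * I ^ l + Ideal.span {w ^ (l + 1)} := by
    rw [← Ideal.span_singleton_pow]
    have hwI : Ideal.span {w} ≤ I := (Ideal.span_singleton_le_iff_mem I).2 (hg _)
    exact sup_pow_succ_le hJI hwI l
  calc _ ≤ Ideal.span {A (MvPolynomial.eval a G)} * (J * I ^ l + Ideal.span {w ^ (l + 1)}) := by
        gcongr
        exact (Ideal.pow_right_mono hgJ _).trans hJw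
    _ = Ideal.span {A (MvPolynomial.eval a G)} * (J * I ^ l) +
        Ideal.span {A (MvPolynomial.eval a G) * w ^ (l + 1)} := by
      rw [mul_add, Ideal.span_singleton_mul_span_singleton]
    _ ≤ _ := sup_le (Ideal.mul_le_right.trans le_sup_left)
      ((Ideal.span_singleton_le_iff_mem _).2 hwJ)

end AlgebraicDependence

/-- If any `N + 1` elements of `R` are algebraically dependent over `C`, then a finitely generated
ideal `I` has, up to a nonzero scalar and modulo higher powers of `I`, a reduction generated by at
most `N` elements. -/
lemma exists_reduction {C R : Type*} [CommRing C] [CommRing R] [Algebra C R] [IsDomain C]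
    [Infinite C] {I : Ideal R} (hI : I.FG) {N : ℕ}
    (hdep : ∀ g : Fin (N + 1) → R, ∃ H : MvPolynomial (Fin (N + 1)) C,
      H ≠ 0 ∧ MvPolynomial.aeval g H = 0) :
    ∃ s ≤ N, ∃ (c : C) (g : Fin s → R) (l : ℕ), c ≠ 0 ∧ (∀ i, g i ∈ I) ∧
      Ideal.span {algebraMap C R c} * I ^ (l + 1) ≤
        Ideal.span (Set.range g) * I ^ l + I ^ (l + 2) := by
  classical
  have hex : ∃ s, ∃ (c : C) (g : Fin s → R) (l : ℕ), c ≠ 0 ∧ (∀ i, g i ∈ I) ∧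
      Ideal.span {algebraMap C R c} * I ^ (l + 1) ≤
        Ideal.span (Set.range g) * I ^ l + I ^ (l + 2) := by
    obtain ⟨n, f, hf⟩ := Submodule.fg_iff_exists_fin_generating_family.1 hI
    have hf' : Ideal.span (Set.range f) = I := hf
    refine ⟨n, 1, f, 0, one_ne_zero, fun i => hf' ▸ Ideal.subset_span ⟨i, rfl⟩, ?_⟩
    rw [hf']
    simp
  refine ⟨Nat.find hex, ?_, Nat.find_spec hex⟩
  by_contra! hN
  obtain ⟨t, ht⟩ : ∃ t, Nat.find hex = t + 1 := ⟨Nat.find hex - 1, by omega⟩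
  have hmin : ¬ _ := Nat.find_min hex (m := t) (by omega)
  have hspec := Nat.find_spec hex
  rw [ht] at hspec
  obtain ⟨c₁, g, l₁, hc₁, hg, h₁⟩ := hspec
  have hle : N + 1 ≤ t + 1 := by omega
  obtain ⟨H, hH, hH0⟩ := hdep (g ∘ Fin.castLE hle)
  obtain ⟨c₂, g', l₂, hc₂, hg', h₂⟩ := exists_reduction_of_aeval_eq_zero hg
    (H := MvPolynomial.rename (Fin.castLE hle) H)
    ((map_ne_zero_iff _ (MvPolynomial.rename_injective _ (Fin.castLE_injective hle))).2 hH)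
    (by rwa [MvPolynomial.aeval_rename])
  refine hmin ⟨c₂ * c₁ ^ (l₂ + 1), g', l₁ + l₂, mul_ne_zero hc₂ (pow_ne_zero _ hc₁), hg', ?_⟩
  rw [map_mul, map_pow]
  exact reduction_trans (Ideal.span_le.2 (Set.range_subset_iff.2 hg)) h₁ h₂

lemma exists_aeval_eq_zero_of_mvPolynomial {K : Type*} [Field K] {N : ℕ}
    (z : MvPolynomial (Fin (N + 1)) K) (g : Fin (N + 1) → MvPolynomial (Fin (N + 1)) K) :
    letI := (Polynomial.aeval (R := K) z).toAlgebra
    ∃ H : MvPolynomial (Fin (N + 1)) (Polynomial K), H ≠ 0 ∧ MvPolynomial.aeval g H = 0 := by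
  let := (Polynomial.aeval (R := K) z).toAlgebra
  have : IsScalarTower K (Polynomial K) (MvPolynomial (Fin (N + 1)) K) :=
    IsScalarTower.of_algHom (Polynomial.aeval (R := K) z)
  have hnot : ¬ AlgebraicIndependent K (fun o : Option (Fin (N + 1)) => o.elim z g) := by
    intro h
    have := h.lift_cardinalMk_le_trdeg
    rw [MvPolynomial.trdeg_of_isDomain] at this
    simp only [Cardinal.mk_fintype, Fintype.card_option, Fintype.card_fin,
      Cardinal.lift_natCast] at this
    norm_cast at this
    omega
  rw [algebraicIndependent_iff] at hnot
  push Not at hnot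
  obtain ⟨P, hP, hP0⟩ := hnot
  refine ⟨MvPolynomial.optionEquivRight K _ P, (map_ne_zero_iff _ (AlgEquiv.injective _)).2 hP0, ?_⟩
  rw [← hP]
  have : ((MvPolynomial.aeval g).restrictScalars K).comp
      (MvPolynomial.optionEquivRight K (Fin (N + 1))).toAlgHom =
      MvPolynomial.aeval (R := K) (fun o : Option (Fin (N + 1)) => o.elim z g) := by
    refine MvPolynomial.algHom_ext fun o => ?_
    cases o with
    | none =>
      simp
      exact Polynomial.aeval_X (R := K) z
    | some i => simp
  exact DFunLike.congr_fun this P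

section Cartier

variable {L σ : Type*} [Field L]

open Classical in
/-- The linear map keeping only the monomials whose exponents are congruent to `ρ` modulo `q`,
and dividing their exponents by `q`. -/
noncomputable def divExponent (q : ℕ) (ρ : σ →₀ ℕ) :
    MvPolynomial σ L →ₗ[L] MvPolynomial σ L :=
  (MvPolynomial.basisMonomials σ L).constr L fun d =>
    if ∀ i, d i % q = ρ i % q then
      MvPolynomial.monomial (d.mapRange (· / q) (Nat.zero_div q)) 1 else 0

open Classical in
lemma divExponent_monomial (q : ℕ) (ρ d : σ →₀ ℕ) (a : L) :
    divExponent q ρ (MvPolynomial.monomial d a) =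
      if ∀ i, d i % q = ρ i % q then
        MvPolynomial.monomial (d.mapRange (· / q) (Nat.zero_div q)) a else 0 := by
  have h := (MvPolynomial.basisMonomials σ L).constr_basis L (fun d : σ →₀ ℕ =>
    if ∀ i, d i % q = ρ i % q then
      MvPolynomial.monomial (R := L) (d.mapRange (· / q) (Nat.zero_div q)) 1 else 0) d
  rw [MvPolynomial.coe_basisMonomials] at h
  have ha : MvPolynomial.monomial d a = a • MvPolynomial.monomial d (1 : L) := by
    simp [MvPolynomial.smul_monomial]
  rw [ha, map_smul, divExponent]
  erw [h]
  split_ifs <;> simp [MvPolynomial.smul_monomial]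

lemma divExponent_expand_mul {q : ℕ} (hq : 0 < q) (ρ : σ →₀ ℕ) (y h : MvPolynomial σ L) :
    divExponent q ρ (MvPolynomial.expand q y * h) = y * divExponent q ρ h := by
  classical
  induction y using MvPolynomial.induction_on' with
  | add y₁ y₂ h₁ h₂ => simp [add_mul, h₁, h₂]
  | monomial κ a =>
    induction h using MvPolynomial.induction_on' with
    | add h₁ h₂ ih₁ ih₂ => simp only [mul_add, map_add, ih₁, ih₂]
    | monomial d b =>
      have hexp : MvPolynomial.expand q (MvPolynomial.monomial κ a) =
          MvPolynomial.monomial (q • κ) a := by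
        simp
      have hmod : (∀ i, (q • κ + d) i % q = ρ i % q) ↔ ∀ i, d i % q = ρ i % q := by
        simp
      have hdiv : (q • κ + d).mapRange (· / q) (Nat.zero_div q) =
          κ + d.mapRange (· / q) (Nat.zero_div q) := by
        ext i
        simp [Nat.mul_add_div hq]
      rw [hexp, MvPolynomial.monomial_mul, divExponent_monomial, divExponent_monomial, hdiv]
      simp only [hmod]
      split_ifs <;> simp [MvPolynomial.monomial_mul]

lemma divExponent_ne_zero {q : ℕ} {ρ : σ →₀ ℕ} {h : MvPolynomial σ L} (hρ : ρ ∈ h.support) :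
    divExponent q ρ h ≠ 0 := by
  classical
  intro h0
  have h1 := congrArg (MvPolynomial.coeff (ρ.mapRange (· / q) (Nat.zero_div q))) h0
  rw [h.as_sum, map_sum, MvPolynomial.coeff_sum, Finset.sum_eq_single ρ] at h1
  · rw [divExponent_monomial, if_pos fun _ => rfl] at h1
    simp at h1
    exact MvPolynomial.mem_support_iff.1 hρ h1
  · intro d _ hd
    rw [divExponent_monomial]
    split_ifs with hdρ
    · rw [MvPolynomial.coeff_monomial, if_neg]
      intro heq
      refine hd (Finsupp.ext fun i => ?_)
      have h2 := DFunLike.congr_fun heq i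
      simp only [Finsupp.mapRange_apply] at h2
      rw [← Nat.div_add_mod (d i) q, ← Nat.div_add_mod (ρ i) q, hdρ i, h2]
    · simp
  · exact fun hn => absurd hρ hn

lemma mul_totalDegree_divExponent_le (q : ℕ) (ρ : σ →₀ ℕ) (h : MvPolynomial σ L) :
    q * (divExponent q ρ h).totalDegree ≤ h.totalDegree := by
  classical
  rcases Nat.eq_zero_or_pos q with rfl | hq
  · simp
  rw [mul_comm, ← Nat.le_div_iff_mul_le hq]
  conv_lhs => rw [h.as_sum, map_sum]
  refine MvPolynomial.totalDegree_finsetSum_le fun d hd => ?_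
  rw [divExponent_monomial]
  split_ifs
  · refine (MvPolynomial.totalDegree_monomial_le _ _).trans ?_
    rw [Nat.le_div_iff_mul_le hq]
    refine le_trans ?_ (MvPolynomial.le_totalDegree hd)
    rw [Finsupp.sum_mapRange_index (by simp), Finsupp.sum, Finsupp.sum, Finset.sum_mul]
    exact Finset.sum_le_sum fun i _ => Nat.div_mul_le_self _ _
  · simp

/-- A `p ^ (-e)`-linear operator that does not kill a given polynomial and divides its degree by
`p ^ e`. -/
lemma exists_cartier (p : ℕ) [Fact p.Prime] [CharP L p] [PerfectRing L p] (e : ℕ)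
    {H : MvPolynomial σ L} (hH : H ≠ 0) :
    ∃ φ : MvPolynomial σ L →+ MvPolynomial σ L,
      (∀ y h, φ (y ^ p ^ e * h) = y * φ h) ∧ φ H ≠ 0 ∧
        p ^ e * (φ H).totalDegree ≤ H.totalDegree := by
  obtain ⟨ρ, hρ⟩ := MvPolynomial.support_nonempty.2 hH
  let r : L →+* L := ((iterateFrobeniusEquiv L p e).symm : L →+* L)
  refine ⟨(MvPolynomial.map r).toAddMonoidHom.comp
    (divExponent (p ^ e) ρ).toAddMonoidHom, fun y h => ?_, ?_, ?_⟩
  · have hy : y ^ p ^ e = MvPolynomial.expand (p ^ e)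
        (MvPolynomial.map (iterateFrobenius L p e) y) := by
      induction y using MvPolynomial.induction_on with
      | C a => simp [iterateFrobenius_def]
      | add a b ha hb => rw [add_pow_char_pow, ha, hb, map_add, map_add]
      | mul_X a i ha =>
        rw [mul_pow, ha, map_mul, map_mul, MvPolynomial.map_X, MvPolynomial.expand_X]
    have hr : MvPolynomial.map r (MvPolynomial.map (iterateFrobenius L p e) y) = y := by
      rw [MvPolynomial.map_map]
      convert MvPolynomial.map_id y
      ext a
      exact (iterateFrobeniusEquiv L p e).symm_apply_apply a
    simp only [AddMonoidHom.coe_comp, Function.comp_apply]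
    change MvPolynomial.map r (divExponent (p ^ e) ρ _) = _ * MvPolynomial.map r (divExponent _ _ _)
    rw [hy, divExponent_expand_mul (pow_pos (Fact.out : p.Prime).pos e), map_mul, hr]
  · change MvPolynomial.map r (divExponent (p ^ e) ρ H) ≠ 0
    exact (map_ne_zero_iff _ (MvPolynomial.map_injective _ r.injective)).2
      (divExponent_ne_zero hρ)
  · change p ^ e * (MvPolynomial.map r (divExponent (p ^ e) ρ H)).totalDegree ≤ _
    refine le_trans (Nat.mul_le_mul_left _ ?_) (mul_totalDegree_divExponent_le (p ^ e) ρ H)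
    exact Finset.sup_mono (MvPolynomial.support_map_subset _ _)

end Cartier

section PositiveCharacteristic

variable {σ L : Type*} [Field L]

lemma apply_mem_of_mem_span_pow {p e : ℕ} {φ : MvPolynomial σ L →+ MvPolynomial σ L}
    (hφ : ∀ y h, φ (y ^ p ^ e * h) = y * φ h) {I : Ideal (MvPolynomial σ L)}
    {x : MvPolynomial σ L} (hx : x ∈ Ideal.span ((· ^ p ^ e) '' (I : Set (MvPolynomial σ L)))) :
    φ x ∈ I := by
  suffices h : ∀ c, φ (c * x) ∈ I by simpa using h 1
  induction hx using Submodule.span_induction with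
  | mem x hx =>
    obtain ⟨y, hy, rfl⟩ := hx
    intro c
    rw [mul_comm, hφ]
    exact Ideal.mul_mem_right _ _ hy
  | zero => simp
  | add x y _ _ hx hy =>
    intro c
    rw [mul_add, map_add]
    exact add_mem (hx c) (hy c)
  | smul a x _ hx =>
    intro c
    rw [smul_eq_mul, ← mul_assoc]
    exact hx _

/-- The degree bound in positive characteristic: `(u * t) ^ b * φ (F ^ a)` lies in `I` for a
`p ^ (-e)`-linear operator `φ` and an exponent `a` close to `N * p ^ e / m`. -/
lemma mul_le_mul_of_charP (p : ℕ) [Fact p.Prime] [CharP L p] [PerfectRing L p]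
    {N r s l m d D : ℕ} (hm : 0 < m) (hs : s ≤ N) {f : Fin r → MvPolynomial σ L}
    {g : Fin s → MvPolynomial σ L} {u t F : MvPolynomial σ L} {I J : Ideal (MvPolynomial σ L)}
    (hI : I = Ideal.span (Set.range f)) (hJ : J = Ideal.span (Set.range g)) (hJI : J ≤ I)
    (hu : Ideal.span {u} * I ^ (l + 1) ≤ J * I ^ l + I ^ (l + 2))
    (ht : t * F ∈ I ^ m) (hF : F ≠ 0) (hFd : F.totalDegree ≤ d)
    (hc : ∀ h : MvPolynomial σ L, h.totalDegree ≤ D → (u * t) ^ (N + r + l + 2) * h ∈ I → h = 0) :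
    m * (D + 1) ≤ N * d := by
  by_contra! hlt
  set e := (1 + l + m) * d with he
  have hq : e < p ^ e := Nat.lt_pow_self (Fact.out : p.Prime).one_lt
  set q := p ^ e with hqdef
  have hq1 : 1 ≤ q := by omega
  set n := s * q + 1 with hn
  set M := r * q + 1 with hM
  set a := (n + l) / m + 1 with ha
  have ham : n + l ≤ a * m := by
    have := Nat.div_add_mod (n + l) m
    have := Nat.mod_lt (n + l) hm
    rw [ha, add_mul, mul_comm _ m]
    omega
  have ham' : a * m ≤ n + l + m := by
    rw [ha, add_mul, one_mul]
    exact Nat.add_le_add_right (Nat.div_mul_le_self _ _) _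
  have han : a ≤ n + l + 1 := Nat.add_le_add_right (Nat.div_le_self _ _) _
  have hsq : s * q ≤ N * q := Nat.mul_le_mul_right q hs
  have hlq : l ≤ l * q := Nat.le_mul_of_pos_right l hq1
  set b := N + r + l + 2 with hb
  have hbq : b * q = N * q + r * q + l * q + 2 * q := by rw [hb]; ring
  set Q := Ideal.span ((· ^ q) '' (I : Set (MvPolynomial σ L))) with hQ
  have hmemQ : ∀ x ∈ I, x ^ q ∈ Q := fun x hx => Ideal.subset_span ⟨x, hx, rfl⟩
  have hJQ : J ^ n ≤ Q := by
    rw [hJ]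
    exact span_range_pow_le g fun i => hmemQ _ (hJI (hJ ▸ Ideal.subset_span ⟨i, rfl⟩))
  have hIQ : I ^ M ≤ Q := by
    nth_rw 1 [hI]
    exact span_range_pow_le f fun i => hmemQ _ (hI ▸ Ideal.subset_span ⟨i, rfl⟩)
  have hkey := span_singleton_pow_mul_le hu hJI hJQ hIQ (n + M) 0 (n + l) (by omega) (by omega)
  have htF : (t * F) ^ a ∈ I ^ (n + l) := by
    refine Ideal.pow_le_pow_right ham ?_
    rw [mul_comm a m, pow_mul]
    exact Ideal.pow_mem_pow ht a
  have hmem : u ^ (n + M) * (t * F) ^ a ∈ Q := by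
    refine hkey (Ideal.mul_mem_mul ?_ (by simpa using htF))
    exact Ideal.pow_mem_pow (Ideal.mem_span_singleton_self u) _
  have hmem' : ((u * t) ^ b) ^ q * F ^ a ∈ Q := by
    obtain ⟨i, hi⟩ := Nat.exists_eq_add_of_le (show n + M ≤ b * q by omega)
    obtain ⟨j, hj⟩ := Nat.exists_eq_add_of_le (show a ≤ b * q by omega)
    have heq : ((u * t) ^ b) ^ q * F ^ a =
        u ^ i * t ^ j * (u ^ (n + M) * (t * F) ^ a) := by
      rw [← pow_mul, mul_pow u t]
      nth_rw 1 [hi]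
      rw [hj]
      ring
    rw [heq]
    exact Ideal.mul_mem_left _ _ hmem
  obtain ⟨φ, hφ, hφF, hdeg⟩ := exists_cartier p e (pow_ne_zero a hF)
  have hφI := apply_mem_of_mem_span_pow hφ hmem'
  rw [hφ] at hφI
  have hD : D + 1 ≤ (φ (F ^ a)).totalDegree := by
    by_contra! h
    exact hφF (hc _ (by omega) hφI)
  have h1 : q * (D + 1) ≤ a * d :=
    calc q * (D + 1) ≤ q * (φ (F ^ a)).totalDegree := Nat.mul_le_mul_left _ hD
      _ ≤ (F ^ a).totalDegree := hdeg
      _ ≤ a * F.totalDegree := MvPolynomial.totalDegree_pow _ _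
      _ ≤ a * d := Nat.mul_le_mul_left _ hFd
  have h2 : q * (N * d + 1) ≤ (N * q + (1 + l + m)) * d :=
    calc q * (N * d + 1) ≤ q * (m * (D + 1)) := Nat.mul_le_mul_left _ hlt
      _ = m * (q * (D + 1)) := by ring
      _ ≤ m * (a * d) := Nat.mul_le_mul_left _ h1
      _ = a * m * d := by ring
      _ ≤ (N * q + (1 + l + m)) * d := Nat.mul_le_mul_right _ (by omega)
  have h3 : q ≤ (1 + l + m) * d := by nlinarith
  omega

end PositiveCharacteristic

section Homogeneous

variable {σ K : Type*} [Field K]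

lemma homogeneousComponent_eq_zero_of_mem_pow {n d : ℕ} {f : MvPolynomial σ K}
    (hf : f ∈ MvPolynomial.idealOfVars σ K ^ n) (hd : d < n) :
    MvPolynomial.homogeneousComponent d f = 0 := by
  classical
  ext x
  rw [MvPolynomial.coeff_homogeneousComponent, MvPolynomial.coeff_zero]
  split_ifs with hx
  · exact (MvPolynomial.mem_pow_idealOfVars_iff' _ _).1 hf x (hx ▸ hd)
  · rfl

lemma isHomogeneousIdeal_pow_idealOfVars (n : ℕ) :
    IsHomogeneousIdeal (MvPolynomial.idealOfVars σ K ^ n) := by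
  classical
  intro f hf d
  rw [MvPolynomial.mem_pow_idealOfVars_iff'] at hf ⊢
  intro x hx
  rw [MvPolynomial.coeff_homogeneousComponent]
  split_ifs
  exacts [hf x hx, rfl]

lemma mem_idealOfVars_iff {f : MvPolynomial σ K} :
    f ∈ MvPolynomial.idealOfVars σ K ↔ MvPolynomial.constantCoeff f = 0 := by
  rw [← pow_one (MvPolynomial.idealOfVars σ K), MvPolynomial.mem_pow_idealOfVars_iff',
    MvPolynomial.constantCoeff_eq]
  refine ⟨fun h => h 0 (by simp), fun h x hx => ?_⟩
  rw [Nat.lt_one_iff, Finsupp.degree_eq_zero_iff] at hx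
  rw [hx, h]

lemma IsHomogeneousIdeal.mem_of_mul_mem {I : Ideal (MvPolynomial σ K)} (hI : IsHomogeneousIdeal I)
    {w g : MvPolynomial σ K} (hw : MvPolynomial.constantCoeff w ≠ 0) (h : w * g ∈ I) : g ∈ I := by
  set c := MvPolynomial.constantCoeff w
  set v := 1 - MvPolynomial.C c⁻¹ * w with hv
  have hvm : v ∈ MvPolynomial.idealOfVars σ K := by
    simp [mem_idealOfVars_iff, hv, c, inv_mul_cancel₀ hw]
  have hk (k : ℕ) : g - v ^ k * g ∈ I := by
    have h1 : (1 - v) * g ∈ I := by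
      rw [hv, sub_sub_cancel, mul_assoc]
      exact I.mul_mem_left _ h
    have h2 : g - v ^ k * g = (∑ i ∈ Finset.range k, v ^ i) * ((1 - v) * g) := by
      rw [← mul_assoc, geom_sum_mul_neg]
      ring
    rw [h2]
    exact I.mul_mem_left _ h1
  rw [← MvPolynomial.sum_homogeneousComponent g]
  refine sum_mem fun d _ => ?_
  have h3 := hI _ (hk (d + 1)) d
  rwa [map_sub, homogeneousComponent_eq_zero_of_mem_pow
    (Ideal.mul_mem_right g _ (Ideal.pow_mem_pow hvm (d + 1))) (Nat.lt_succ_self d), sub_zero] at h3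

lemma IsHomogeneousIdeal.le_pow_alphaDeg {I : Ideal (MvPolynomial σ K)}
    (hI : IsHomogeneousIdeal I) : I ≤ MvPolynomial.idealOfVars σ K ^ alphaDeg I := by
  classical
  intro f hf
  rw [MvPolynomial.mem_pow_idealOfVars_iff']
  intro x hx
  have h0 : MvPolynomial.homogeneousComponent x.degree f = 0 := by
    by_contra h
    exact Nat.notMem_of_lt_sInf hx
      ⟨_, hI f hf _, h, MvPolynomial.homogeneousComponent_isHomogeneous _ _⟩
  have h1 := congrArg (MvPolynomial.coeff x) h0
  rwa [MvPolynomial.coeff_homogeneousComponent, if_pos rfl, MvPolynomial.coeff_zero] at h1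

lemma IsHomogeneousIdeal.mem_of_aeval_mul_mem {I : Ideal (MvPolynomial σ K)}
    (hI : IsHomogeneousIdeal I) {z : MvPolynomial σ K} (hz : MvPolynomial.constantCoeff z = 0)
    (hzI : ∀ g, z * g ∈ I → g ∈ I) {c : Polynomial K} (hc : c ≠ 0) {g : MvPolynomial σ K}
    (h : Polynomial.aeval z c * g ∈ I) : g ∈ I := by
  obtain ⟨c', hc', hX⟩ := Polynomial.exists_eq_pow_rootMultiplicity_mul_and_not_dvd c hc 0
  rw [map_zero, sub_zero] at hc' hX
  rw [hc', map_mul, map_pow, Polynomial.aeval_X, mul_assoc] at h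
  have hpow : ∀ (k : ℕ) (y), z ^ k * y ∈ I → y ∈ I := by
    intro k
    induction k with
    | zero => simp
    | succ k ih =>
      intro y hy
      rw [pow_succ, mul_assoc] at hy
      exact hzI _ (ih _ hy)
  refine hI.mem_of_mul_mem ?_ (hpow _ _ h)
  rw [Polynomial.X_dvd_iff] at hX
  have : MvPolynomial.constantCoeff (Polynomial.aeval z c') = c'.coeff 0 := by
    rw [Polynomial.aeval_def, Polynomial.hom_eval₂, hz, Polynomial.eval₂_at_zero]
    simp [MvPolynomial.algebraMap_eq]
  rwa [this]

lemma IsHomogeneousIdeal.exists_eq_span [Finite σ] {I : Ideal (MvPolynomial σ K)}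
    (hI : IsHomogeneousIdeal I) :
    ∃ (r : ℕ) (f : Fin r → MvPolynomial σ K) (e : Fin r → ℕ),
      (∀ i, (f i).IsHomogeneous (e i)) ∧ I = Ideal.span (Set.range f) := by
  set S : Set (MvPolynomial σ K) := {f | f ∈ I ∧ ∃ e, f.IsHomogeneous e} with hS
  have hspan : I = Ideal.span S := by
    refine le_antisymm (fun f hf => ?_) (Ideal.span_le.2 fun f hf => hf.1)
    rw [← MvPolynomial.sum_homogeneousComponent f]
    exact sum_mem fun d _ => Ideal.subset_span
      ⟨hI f hf d, d, MvPolynomial.homogeneousComponent_isHomogeneous _ _⟩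
  obtain ⟨s, hsS, hs⟩ := (Submodule.fg_span_iff_fg_span_finset_subset S).1
    (IsNoetherian.noetherian (Submodule.span (MvPolynomial σ K) S))
  have hmem (i : Fin s.card) : (s.equivFin.symm i : MvPolynomial σ K) ∈ S :=
    hsS (s.equivFin.symm i).2
  refine ⟨s.card, fun i => s.equivFin.symm i, fun i => (hmem i).2.choose,
    fun i => (hmem i).2.choose_spec, ?_⟩
  have hrange : Set.range (fun i => (s.equivFin.symm i : MvPolynomial σ K)) = s := by
    ext x
    constructor
    · rintro ⟨i, rfl⟩
      exact (s.equivFin.symm i).2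
    · exact fun hx => ⟨s.equivFin ⟨x, hx⟩, by simp⟩
  rw [hrange, hspan]
  exact hs

end Homogeneous

lemma exists_mem_forall_mem_of_mul_mem {R : Type*} [CommRing R] [IsNoetherianRing R]
    {I J : Ideal R} (hJ : ∀ P ∈ associatedPrimes R (R ⧸ I), ¬ J ≤ P) :
    ∃ z ∈ J, ∀ g, z * g ∈ I → g ∈ I := by
  by_contra! hz
  have hsub : (J : Set R) ⊆ ⋃ P ∈ associatedPrimes R (R ⧸ I), (id P : Ideal R) := by
    simp_rw [id, biUnion_associatedPrimes_eq_zero_divisors]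
    intro x hx
    obtain ⟨g, hg, hgI⟩ := hz x hx
    refine ⟨Ideal.Quotient.mk I g, fun h => hgI (Ideal.Quotient.eq_zero_iff_mem.1 h), ?_⟩
    exact Ideal.Quotient.eq_zero_iff_mem.2 hg
  obtain ⟨P, hP, hle⟩ := (Ideal.subset_union_prime_finite
    (associatedPrimes.finite R (R ⧸ I)) 0 0 fun P hP _ _ => hP.isPrime).1 hsub
  exact hJ P hP hle

section Descent

open Filter Pointwise

variable {σ K : Type*} [Field K]

/-- The subring of `K` generated by a finite set. -/
abbrev coeffRing (E : Finset K) : Subalgebra ℤ K := Algebra.adjoin ℤ (E : Set K)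

/-- The inclusion of the polynomials with coefficients in `coeffRing E`. -/
abbrev coeffInclusion (σ : Type*) (E : Finset K) :
    MvPolynomial σ (coeffRing E) →+* MvPolynomial σ K :=
  MvPolynomial.map (algebraMap (coeffRing E) K)

lemma coeffInclusion_injective (E : Finset K) : Function.Injective (coeffInclusion σ E) :=
  MvPolynomial.map_injective _ Subtype.val_injective

lemma eventually_mem_coeffRing (a : K) : ∀ᶠ E in atTop, a ∈ coeffRing E := by
  filter_upwards [eventually_ge_atTop {a}] with E hE
  exact Algebra.subset_adjoin (hE (Finset.mem_singleton_self a))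

lemma eventually_exists_coeffInclusion_eq (h : MvPolynomial σ K) :
    ∀ᶠ E in atTop, ∃ y, coeffInclusion σ E y = h := by
  filter_upwards [eventually_ge_atTop h.coeffs] with E hE
  refine MvPolynomial.mem_range_map_iff_coeffs_subset.2 fun a ha => ?_
  exact ⟨⟨a, Algebra.subset_adjoin (hE ha)⟩, rfl⟩

/-- Membership in the ideal `S` is inherited by the ideals `T E` over the rings `coeffRing E`, for
all large enough `E`. -/
def Descends (T : ∀ E : Finset K, Ideal (MvPolynomial σ (coeffRing E)))
    (S : Ideal (MvPolynomial σ K)) : Prop :=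
  ∀ h ∈ S, ∀ᶠ E in atTop, ∀ y, coeffInclusion σ E y = h → y ∈ T E

variable {T T' : ∀ E : Finset K, Ideal (MvPolynomial σ (coeffRing E))}
  {S S' : Ideal (MvPolynomial σ K)}

lemma descends_span (s : Set (MvPolynomial σ K)) :
    Descends (fun E => Ideal.span (coeffInclusion σ E ⁻¹' s)) (Ideal.span s) := by
  intro h hh
  induction hh using Submodule.span_induction with
  | mem x hx => exact Eventually.of_forall fun E y hy => Ideal.subset_span (by simpa [hy] using hx)
  | zero =>
    refine Eventually.of_forall fun E y hy => ?_
    rw [coeffInclusion_injective E (hy.trans (map_zero _).symm)]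
    exact zero_mem _
  | add a b _ _ ha hb =>
    filter_upwards [ha, hb, eventually_exists_coeffInclusion_eq a,
      eventually_exists_coeffInclusion_eq b] with E ha hb ⟨a', ha'⟩ ⟨b', hb'⟩ y hy
    obtain rfl : y = a' + b' := coeffInclusion_injective E (by rw [hy, map_add, ha', hb'])
    exact add_mem (ha _ ha') (hb _ hb')
  | smul c a _ ha =>
    filter_upwards [ha, eventually_exists_coeffInclusion_eq a,
      eventually_exists_coeffInclusion_eq c] with E ha ⟨a', ha'⟩ ⟨c', hc'⟩ y hy
    obtain rfl : y = c' * a' :=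
      coeffInclusion_injective E (by rw [hy, map_mul, ha', hc', smul_eq_mul])
    exact Ideal.mul_mem_left _ _ (ha _ ha')

lemma Descends.mul (hS : Descends T S) (hS' : Descends T' S') :
    Descends (fun E => T E * T' E) (S * S') := by
  intro h hh
  induction hh using Submodule.mul_induction_on' with
  | mem_mul_mem a ha b hb =>
    filter_upwards [hS a ha, hS' b hb, eventually_exists_coeffInclusion_eq a,
      eventually_exists_coeffInclusion_eq b] with E ha hb ⟨a', ha'⟩ ⟨b', hb'⟩ y hy
    obtain rfl : y = a' * b' := coeffInclusion_injective E (by rw [hy, map_mul, ha', hb'])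
    exact Ideal.mul_mem_mul (ha _ ha') (hb _ hb')
  | add a _ b _ ha hb =>
    filter_upwards [ha, hb, eventually_exists_coeffInclusion_eq a,
      eventually_exists_coeffInclusion_eq b] with E ha hb ⟨a', ha'⟩ ⟨b', hb'⟩ y hy
    obtain rfl : y = a' + b' := coeffInclusion_injective E (by rw [hy, map_add, ha', hb'])
    exact add_mem (ha _ ha') (hb _ hb')

lemma Descends.add (hS : Descends T S) (hS' : Descends T' S') :
    Descends (fun E => T E + T' E) (S + S') := by
  intro h hh
  obtain ⟨a, ha, b, hb, rfl⟩ := Submodule.mem_sup.1 hh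
  filter_upwards [hS a ha, hS' b hb, eventually_exists_coeffInclusion_eq a,
    eventually_exists_coeffInclusion_eq b] with E ha hb ⟨a', ha'⟩ ⟨b', hb'⟩ y hy
  obtain rfl : y = a' + b' := coeffInclusion_injective E (by rw [hy, map_add, ha', hb'])
  exact add_mem (Ideal.mem_sup_left (ha _ ha')) (Ideal.mem_sup_right (hb _ hb'))

lemma Descends.pow (hS : Descends T S) (n : ℕ) : Descends (fun E => T E ^ n) (S ^ n) := by
  induction n with
  | zero =>
    intro h _
    refine Eventually.of_forall fun E y _ => ?_
    simp
  | succ n ih =>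
    simp_rw [pow_succ]
    exact ih.mul hS

lemma Descends.eventually_span_le (hS : Descends T S) {s : Set (MvPolynomial σ K)}
    (hs : s.Finite) (h : s ⊆ S) :
    ∀ᶠ E in atTop, Ideal.span (coeffInclusion σ E ⁻¹' s) ≤ T E := by
  filter_upwards [(eventually_all_finite hs).2 fun x hx => hS x (h hx)] with E hE
  exact Ideal.span_le.2 fun y hy => hE _ hy y rfl

lemma Descends.eventually_span_mul_span_pow_le (hS : Descends T S) {s : Set (MvPolynomial σ K)}
    (hs : s.Finite) (u : MvPolynomial σ K) (n : ℕ)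
    (h : Ideal.span {u} * Ideal.span s ^ n ≤ S) :
    ∀ᶠ E in atTop, ∀ u', coeffInclusion σ E u' = u →
      Ideal.span {u'} * Ideal.span (coeffInclusion σ E ⁻¹' s) ^ n ≤ T E := by
  have hfin : (s ^ n).Finite := by
    clear h
    induction n with
    | zero => simp
    | succ n ih => rw [pow_succ]; exact ih.mul hs
  rw [Ideal.span, Ideal.span, Submodule.span_pow, Submodule.span_mul_span, Submodule.span_le] at h
  filter_upwards [(eventually_all_finite hfin).2 fun x hx =>
    hS (u * x) (h (Set.mul_mem_mul rfl hx))] with E hE u' hu'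
  rw [Ideal.span, Ideal.span, Submodule.span_pow, Submodule.span_mul_span, Submodule.span_le]
  rintro _ ⟨_, rfl, x, hx, rfl⟩
  refine hE (coeffInclusion σ E x) ?_ _ (by rw [← hu', ← map_mul])
  have hx' := Set.mem_image_of_mem (coeffInclusion σ E) hx
  rw [Set.image_pow] at hx'
  exact Set.pow_subset_pow_left (Set.image_preimage_subset _ s) hx'

end Descent

lemma isJacobsonRing_int : IsJacobsonRing ℤ := by
  refine isJacobsonRing_iff_prime_eq.2 fun P hP => ?_
  by_cases hP0 : P = ⊥
  · subst hP0
    refine le_antisymm (fun x hx => ?_) Ideal.le_jacobson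
    have h1 := Ideal.mem_jacobson_bot.1 hx 1
    have h2 := Ideal.mem_jacobson_bot.1 hx 2
    rw [Int.isUnit_iff] at h1 h2
    rw [Ideal.mem_bot]
    omega
  · exact Ideal.jacobson_eq_self_of_isMaximal (H := hP.isMaximal hP0)

universe u

lemma exists_ringHom_field_charP (A : Type u) [CommRing A] [Nontrivial A] [Algebra.FiniteType ℤ A] :
    ∃ (L : Type u) (_ : Field L) (p : ℕ) (_ : Fact p.Prime) (_ : CharP L p) (_ : PerfectRing L p),
      Nonempty (A →+* L) := by
  obtain ⟨M, hM⟩ := Ideal.exists_maximal A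
  let _ := Ideal.Quotient.field M
  have hft : Algebra.FiniteType ℤ (A ⧸ M) := inferInstance
  have := isJacobsonRing_int
  have hfin : Module.Finite ℤ (A ⧸ M) := finite_of_finite_type_of_isJacobsonRing ℤ (A ⧸ M)
  obtain ⟨p, hp⟩ := CharP.exists (A ⧸ M)
  have hp0 : p ≠ 0 := by
    rintro rfl
    have := CharP.charP_to_charZero (A ⧸ M)
    have hint : Algebra.IsIntegral ℤ (A ⧸ M) := inferInstance
    exact Int.not_isField (isField_of_isIntegral_of_isField
      (FaithfulSMul.algebraMap_injective ℤ (A ⧸ M)) (Field.toIsField (A ⧸ M)))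
  have hpp : Fact p.Prime := ⟨(CharP.char_is_prime_or_zero (A ⧸ M) p).resolve_right hp0⟩
  have hchar : CharP (AlgebraicClosure (A ⧸ M)) p :=
    charP_of_injective_algebraMap (algebraMap (A ⧸ M) _).injective p
  exact ⟨AlgebraicClosure (A ⧸ M), inferInstance, p, hpp, hchar,
    PerfectField.toPerfectRing p, ⟨(algebraMap (A ⧸ M) _).comp (Ideal.Quotient.mk M)⟩⟩

section MonomialExtension

variable {σ : Type*}

/-- The linear map with prescribed values on the monomials. -/
def monomialExtend {B : Type*} [CommRing B] (T : (σ →₀ ℕ) → MvPolynomial σ B) :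
    MvPolynomial σ B →ₗ[B] MvPolynomial σ B :=
  (MvPolynomial.basisMonomials σ B).constr B T

lemma monomialExtend_monomial {B : Type*} [CommRing B] (T : (σ →₀ ℕ) → MvPolynomial σ B)
    (ν : σ →₀ ℕ) (a : B) : monomialExtend T (MvPolynomial.monomial ν a) = a • T ν := by
  have h : MvPolynomial.monomial ν a = a • MvPolynomial.basisMonomials σ B ν := by
    simp [MvPolynomial.smul_monomial]
  rw [h, map_smul, monomialExtend, Module.Basis.constr_basis]

lemma monomialExtend_congr {B : Type*} [CommRing B] {T : (σ →₀ ℕ) → MvPolynomial σ B}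
    {Λ : MvPolynomial σ B →ₗ[B] MvPolynomial σ B} {h : MvPolynomial σ B}
    (hT : ∀ ν ∈ h.support, T ν = Λ (MvPolynomial.monomial ν 1)) :
    monomialExtend T h = Λ h := by
  rw [h.as_sum, map_sum, map_sum]
  refine Finset.sum_congr rfl fun ν hν => ?_
  rw [monomialExtend_monomial, hT ν hν, ← map_smul, MvPolynomial.smul_monomial, smul_eq_mul,
    mul_one]

lemma map_monomialExtend {A B : Type*} [CommRing A] [CommRing B] (ρ : A →+* B)
    (T : (σ →₀ ℕ) → MvPolynomial σ A) (h : MvPolynomial σ A) :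
    MvPolynomial.map ρ (monomialExtend T h) =
      monomialExtend (fun ν => MvPolynomial.map ρ (T ν)) (MvPolynomial.map ρ h) := by
  induction h using MvPolynomial.induction_on' with
  | monomial ν a =>
    rw [monomialExtend_monomial, MvPolynomial.map_monomial, monomialExtend_monomial,
      MvPolynomial.smul_eq_C_mul, MvPolynomial.smul_eq_C_mul, map_mul, MvPolynomial.map_C]
  | add p q hp hq => rw [map_add, map_add, map_add, map_add, hp, hq]

lemma eq_zero_of_mul_mem_of_monomialExtend {B : Type*} [CommRing B]
    {T : (σ →₀ ℕ) → MvPolynomial σ B} {s : Set (MvPolynomial σ B)} {w : MvPolynomial σ B} {D : ℕ}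
    (hs : ∀ ν, ∀ f ∈ s, monomialExtend T (MvPolynomial.monomial ν 1 * f) = 0)
    (hw : ∀ μ : σ →₀ ℕ, μ.degree ≤ D →
      monomialExtend T (w * MvPolynomial.monomial μ 1) = MvPolynomial.monomial μ 1)
    {h : MvPolynomial σ B} (hD : h.totalDegree ≤ D) (hh : w * h ∈ Ideal.span s) : h = 0 := by
  have hI : ∀ y ∈ Ideal.span s, ∀ x, monomialExtend T (x * y) = 0 := by
    intro y hy
    induction hy using Submodule.span_induction with
    | mem f hf =>
      intro x
      rw [x.as_sum, Finset.sum_mul, map_sum]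
      refine Finset.sum_eq_zero fun ν _ => ?_
      have hν : MvPolynomial.monomial ν (x.coeff ν) =
          x.coeff ν • MvPolynomial.monomial ν (1 : B) := by
        rw [MvPolynomial.smul_monomial, smul_eq_mul, mul_one]
      rw [hν, smul_mul_assoc, map_smul, hs ν f hf, smul_zero]
    | zero => simp
    | add a b _ _ ha hb =>
      intro x
      rw [mul_add, map_add, ha, hb, add_zero]
    | smul c a _ ha =>
      intro x
      rw [smul_eq_mul, ← mul_assoc, ha]
  have h0 : monomialExtend T (w * h) = 0 := by simpa using hI _ hh 1
  rw [← h0]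
  conv_lhs => rw [h.as_sum]
  conv_rhs => rw [h.as_sum, Finset.mul_sum, map_sum]
  refine Finset.sum_congr rfl fun μ hμ => ?_
  rw [← mul_one (h.coeff μ), ← smul_eq_mul, ← MvPolynomial.smul_monomial, mul_smul_comm,
    map_smul, hw μ ((MvPolynomial.le_totalDegree hμ).trans hD)]

/-- The condition `hc` is witnessed by a linear map that takes finitely many values on monomials and
inverts the multiplication by `w` modulo `f` in degrees at most `D`. -/
lemma exists_monomialExtend {K : Type*} [Field K] [Finite σ] {ι : Type*}
    {f : ι → MvPolynomial σ K} {e : ι → ℕ} (hf : ∀ i, (f i).IsHomogeneous (e i))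
    {w : MvPolynomial σ K} {D : ℕ}
    (hc : ∀ h : MvPolynomial σ K, h.totalDegree ≤ D → w * h ∈ Ideal.span (Set.range f) → h = 0) :
    ∃ T : (σ →₀ ℕ) → MvPolynomial σ K, (Set.range T).Finite ∧
      (∀ ν i, monomialExtend T (MvPolynomial.monomial ν 1 * f i) = 0) ∧
      ∀ μ : σ →₀ ℕ, μ.degree ≤ D →
        monomialExtend T (w * MvPolynomial.monomial μ 1) = MvPolynomial.monomial μ 1 := by
  classical
  let V := MvPolynomial.restrictTotalDegree σ K D
  let W := (Ideal.span (Set.range f)).restrictScalars K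
  let j : V →ₗ[K] MvPolynomial σ K ⧸ W :=
    W.mkQ ∘ₗ LinearMap.mulLeft K w ∘ₗ V.subtype
  have hj : LinearMap.ker j = ⊥ := by
    rw [LinearMap.ker_eq_bot']
    intro h hh
    refine Subtype.ext (hc h ((MvPolynomial.mem_restrictTotalDegree ..).1 h.2) ?_)
    exact (Submodule.Quotient.mk_eq_zero W).1 hh
  obtain ⟨s, hs⟩ := LinearMap.exists_leftInverse_of_injective j hj
  let Λ : MvPolynomial σ K →ₗ[K] MvPolynomial σ K := V.subtype ∘ₗ s ∘ₗ W.mkQ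
  have hΛ0 : ∀ h ∈ Ideal.span (Set.range f), Λ h = 0 := by
    intro h hh
    have : W.mkQ h = 0 := (Submodule.Quotient.mk_eq_zero W).2 hh
    simp [Λ, this]
  have hΛ : ∀ h : MvPolynomial σ K, h.totalDegree ≤ D → Λ (w * h) = h := by
    intro h hh
    have := LinearMap.congr_fun hs ⟨h, (MvPolynomial.mem_restrictTotalDegree ..).2 hh⟩
    exact congrArg Subtype.val this
  set B := w.totalDegree + D
  let T : (σ →₀ ℕ) → MvPolynomial σ K := fun ν =>
    if ν.degree ≤ B then Λ (MvPolynomial.monomial ν 1) else 0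
  refine ⟨T, ?_, fun ν i => ?_, fun μ hμ => ?_⟩
  · refine (((Finsupp.finite_of_degree_le B).image fun ν : σ →₀ ℕ =>
      Λ (MvPolynomial.monomial ν 1)).union (Set.finite_singleton 0)).subset ?_
    rintro _ ⟨ν, rfl⟩
    by_cases hν : ν.degree ≤ B
    · exact Or.inl ⟨ν, hν, by simp [T, hν]⟩
    · exact Or.inr (by simp [T, hν])
  · have hhom : (MvPolynomial.monomial ν 1 * f i).IsHomogeneous (ν.degree + e i) :=
      (MvPolynomial.isHomogeneous_monomial 1 rfl).mul (hf i)
    have hdeg : ∀ κ ∈ (MvPolynomial.monomial ν 1 * f i).support, κ.degree = ν.degree + e i := by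
      intro κ hκ
      by_contra hne
      exact MvPolynomial.mem_support_iff.1 hκ (hhom.coeff_eq_zero hne)
    by_cases hle : ν.degree + e i ≤ B
    · rw [monomialExtend_congr (Λ := Λ) fun κ hκ => if_pos ((hdeg κ hκ).trans_le hle)]
      exact hΛ0 _ (Ideal.mul_mem_left _ _ (Ideal.subset_span ⟨i, rfl⟩))
    · refine (monomialExtend_congr (Λ := 0) fun κ hκ => ?_).trans (LinearMap.zero_apply _)
      exact if_neg (by rwa [hdeg κ hκ])
  · have hμ' : (MvPolynomial.monomial μ (1 : K)).totalDegree ≤ D :=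
      (MvPolynomial.totalDegree_monomial_le _ _).trans hμ
    rw [monomialExtend_congr (Λ := Λ) fun κ hκ => if_pos ?_, hΛ _ hμ']
    exact (MvPolynomial.le_totalDegree hκ).trans
      ((MvPolynomial.totalDegree_mul _ _).trans (Nat.add_le_add_left hμ' _))

end MonomialExtension

section Transfer

open Filter

variable {σ K : Type*} [Field K] [Finite σ]

lemma preimage_range_eq_range_of_injective {α β ι : Type*} {j : α → β} (hj : Function.Injective j)
    {f : ι → β} {f' : ι → α} (h : ∀ i, j (f' i) = f i) : j ⁻¹' Set.range f = Set.range f' := by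
  ext x
  constructor
  · rintro ⟨i, hi⟩
    exact ⟨i, hj ((h i).trans hi)⟩
  · rintro ⟨i, rfl⟩
    exact ⟨i, (h i).symm⟩

/-- The degree bound over an arbitrary field, by descending the data to a finitely generated
subring and specialising to positive characteristic. -/
lemma mul_le_mul_of_reduction {N r s l m d D : ℕ} (hm : 0 < m) (hs : s ≤ N)
    {f : Fin r → MvPolynomial σ K} {e : Fin r → ℕ} (hf : ∀ i, (f i).IsHomogeneous (e i))
    {g : Fin s → MvPolynomial σ K} {u t F : MvPolynomial σ K} {I J : Ideal (MvPolynomial σ K)}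
    (hI : I = Ideal.span (Set.range f)) (hJ : J = Ideal.span (Set.range g)) (hJI : J ≤ I)
    (hu : Ideal.span {u} * I ^ (l + 1) ≤ J * I ^ l + I ^ (l + 2))
    (ht : t * F ∈ I ^ m) (hF : F ≠ 0) (hFd : F.totalDegree ≤ d)
    (hc : ∀ h : MvPolynomial σ K, h.totalDegree ≤ D → (u * t) ^ (N + r + l + 2) * h ∈ I → h = 0) :
    m * (D + 1) ≤ N * d := by
  subst hI hJ
  obtain ⟨T, hTfin, hTf, hTw⟩ := exists_monomialExtend hf hc
  obtain ⟨κ, hκ⟩ := MvPolynomial.ne_zero_iff.1 hF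
  have hIdesc := descends_span (Set.range f)
  have hJdesc := descends_span (Set.range g)
  have hTlift := (eventually_all_finite hTfin).2 fun y _ => eventually_exists_coeffInclusion_eq y
  obtain ⟨E, hfE, hgE, hTE, ⟨u', hu'⟩, ⟨t', ht'⟩, ⟨F', hF'⟩, hinv, hJI', huI, htI⟩ :=
    ((eventually_all.2 fun i => eventually_exists_coeffInclusion_eq (f i)).and
    ((eventually_all.2 fun i => eventually_exists_coeffInclusion_eq (g i)).and
    (hTlift.and
    ((eventually_exists_coeffInclusion_eq u).and
    ((eventually_exists_coeffInclusion_eq t).and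
    ((eventually_exists_coeffInclusion_eq F).and
    ((eventually_mem_coeffRing (F.coeff κ)⁻¹).and
    ((hIdesc.eventually_span_le (Set.finite_range g) (Ideal.span_le.1 hJI)).and
    ((((hJdesc.mul (hIdesc.pow l)).add (hIdesc.pow (l + 2))).eventually_span_mul_span_pow_le
      (Set.finite_range f) u (l + 1) hu).and
    (hIdesc.pow m _ ht)))))))))).exists
  choose f' hf' using hfE
  choose g' hg' using hgE
  have hTE' : ∀ ν, ∃ y, coeffInclusion σ E y = T ν := fun ν => hTE _ ⟨ν, rfl⟩
  choose T' hT' using hTE'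
  have hinj := coeffInclusion_injective (σ := σ) E
  have hfr := preimage_range_eq_range_of_injective hinj hf'
  have hgr := preimage_range_eq_range_of_injective hinj hg'
  have huI' := huI u' hu'
  have htI' : t' * F' ∈ Ideal.span (Set.range f') ^ m := by
    rw [← hfr]
    exact htI _ (by rw [map_mul, ht', hF'])
  simp only [hfr, hgr] at hJI' huI'
  have hfin : Algebra.FiniteType ℤ (coeffRing E) := .adjoin_of_finite E.finite_toSet
  obtain ⟨L, _, p, _, _, _, ⟨φ⟩⟩ := exists_ringHom_field_charP (coeffRing E)
  have hmapf : Ideal.span (Set.range fun i => MvPolynomial.map φ (f' i)) =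
      (Ideal.span (Set.range f')).map (MvPolynomial.map φ) := by
    rw [Ideal.map_span, ← Set.range_comp]
    rfl
  have hmapg : Ideal.span (Set.range fun i => MvPolynomial.map φ (g' i)) =
      (Ideal.span (Set.range g')).map (MvPolynomial.map φ) := by
    rw [Ideal.map_span, ← Set.range_comp]
    rfl
  have hT0 (ν : σ →₀ ℕ) (i : Fin r) : monomialExtend T' (MvPolynomial.monomial ν 1 * f' i) = 0 := by
    apply hinj
    rw [coeffInclusion, map_monomialExtend, map_mul, MvPolynomial.map_monomial, map_one, map_zero,
      hf', funext hT', hTf]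
  have hT1 (μ : σ →₀ ℕ) (hμ : μ.degree ≤ D) :
      monomialExtend T' ((u' * t') ^ (N + r + l + 2) * MvPolynomial.monomial μ 1) =
        MvPolynomial.monomial μ 1 := by
    have hw : coeffInclusion σ E ((u' * t') ^ (N + r + l + 2) * MvPolynomial.monomial μ 1) =
        (u * t) ^ (N + r + l + 2) * MvPolynomial.monomial μ 1 := by
      rw [map_mul, map_pow, map_mul, hu', ht', coeffInclusion, MvPolynomial.map_monomial,
        map_one (algebraMap _ _)]
    have hμ' := hTw μ hμ
    rw [← hw, ← funext hT'] at hμ'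
    apply hinj
    refine (map_monomialExtend _ _ _).trans (hμ'.trans ?_)
    rw [coeffInclusion, MvPolynomial.map_monomial, map_one (algebraMap _ _)]
  have hcoeff : (algebraMap (coeffRing E) K) (F'.coeff κ) = F.coeff κ := by
    rw [← hF', MvPolynomial.coeff_map]
  refine mul_le_mul_of_charP p (l := l) hm hs (f := fun i => MvPolynomial.map φ (f' i))
    (g := fun i => MvPolynomial.map φ (g' i)) (u := MvPolynomial.map φ u')
    (t := MvPolynomial.map φ t') (F := MvPolynomial.map φ F') rfl rfl ?_ ?_ ?_ ?_ ?_ ?_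
  · rw [hmapf, hmapg]
    exact Ideal.map_mono hJI'
  · have h := Ideal.map_mono (f := MvPolynomial.map φ) huI'
    rw [Submodule.add_eq_sup, Ideal.map_sup, Ideal.map_mul, Ideal.map_mul, Ideal.map_pow,
      Ideal.map_pow, Ideal.map_pow, Ideal.map_span, Set.image_singleton] at h
    rwa [hmapf, hmapg]
  · rw [hmapf, ← Ideal.map_pow, ← map_mul]
    exact Ideal.mem_map_of_mem _ htI'
  · refine MvPolynomial.ne_zero_iff.2 ⟨κ, fun h0 => ?_⟩
    have h1 : F'.coeff κ * ⟨(F.coeff κ)⁻¹, hinv⟩ = 1 := by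
      apply Subtype.ext
      change algebraMap (coeffRing E) K (F'.coeff κ) * _ = 1
      rw [hcoeff, mul_inv_cancel₀ hκ]
    have h2 := congrArg φ h1
    rw [map_mul, ← MvPolynomial.coeff_map, h0, zero_mul, map_one] at h2
    exact zero_ne_one h2
  · refine le_trans ?_ hFd
    rw [← hF']
    refine Finset.sup_mono ?_
    refine (MvPolynomial.support_map_subset _ _).trans_eq ?_
    exact (MvPolynomial.support_map_of_injective _ Subtype.val_injective).symm
  · intro h hD hh
    refine eq_zero_of_mul_mem_of_monomialExtend (T := fun ν => MvPolynomial.map φ (T' ν))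
      ?_ ?_ hD hh
    · rintro ν _ ⟨i, rfl⟩
      have h1 := congrArg (MvPolynomial.map φ) (hT0 ν i)
      rwa [map_monomialExtend, map_mul, MvPolynomial.map_monomial, map_one, map_zero] at h1
    · intro μ hμ
      have hw : MvPolynomial.map φ ((u' * t') ^ (N + r + l + 2) * MvPolynomial.monomial μ 1) =
          (MvPolynomial.map φ u' * MvPolynomial.map φ t') ^ (N + r + l + 2) *
            MvPolynomial.monomial μ 1 := by
        rw [map_mul, map_pow, map_mul, MvPolynomial.map_monomial, map_one φ]
      have h1 := congrArg (MvPolynomial.map φ) (hT1 μ hμ)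
      rwa [map_monomialExtend, hw, MvPolynomial.map_monomial, map_one φ] at h1

end Transfer

section Main

variable {σ K : Type*} [Field K]

lemma le_totalDegree_of_mem_pow_idealOfVars {n : ℕ} {f : MvPolynomial σ K}
    (hf : f ∈ MvPolynomial.idealOfVars σ K ^ n) (h0 : f ≠ 0) : n ≤ f.totalDegree := by
  classical
  obtain ⟨x, hx⟩ := MvPolynomial.ne_zero_iff.1 h0
  refine le_trans ?_ (MvPolynomial.le_totalDegree (MvPolynomial.mem_support_iff.2 hx))
  by_contra! h
  exact hx ((MvPolynomial.mem_pow_idealOfVars_iff' _ _).1 hf x h)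

lemma pow_le_symbolicPower {R : Type*} [CommRing R] (I : Ideal R) (m : ℕ) :
    I ^ m ≤ symbolicPower I m := fun x hx P hP =>
  ⟨1, fun h => hP.isPrime.ne_top (Ideal.eq_top_of_isUnit_mem _ h isUnit_one), by simpa using hx⟩

lemma IsHomogeneousIdeal.exists_isHomogeneous_mem_symbolicPower {I : Ideal (MvPolynomial σ K)}
    (hI : IsHomogeneousIdeal I) (hne : I ≠ ⊥) (m : ℕ) :
    ∃ F ∈ symbolicPower I m, F ≠ 0 ∧ F.IsHomogeneous (alphaDeg (symbolicPower I m)) := by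
  obtain ⟨f, hf, hf0⟩ := Submodule.exists_mem_ne_zero_of_ne_bot hne
  obtain ⟨d, hd⟩ : ∃ d, MvPolynomial.homogeneousComponent d f ≠ 0 := by
    by_contra! h
    refine hf0 ?_
    rw [← MvPolynomial.sum_homogeneousComponent f]
    exact Finset.sum_eq_zero fun d _ => h d
  exact Nat.sInf_mem (s := {d | ∃ f ∈ symbolicPower I m, f ≠ 0 ∧ f.IsHomogeneous d})
    ⟨d * m, MvPolynomial.homogeneousComponent d f ^ m,
      pow_le_symbolicPower I m (Ideal.pow_mem_pow (hI f hf d) m), pow_ne_zero m hd,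
      (MvPolynomial.homogeneousComponent_isHomogeneous d f).pow m⟩

lemma IsHomogeneousIdeal.mul_alphaDeg_le {N : ℕ} {I : Ideal (MvPolynomial (Fin (N + 1)) K)}
    (hI : IsHomogeneousIdeal I) (hN : 1 ≤ N) {m : ℕ} (hm : 0 < m)
    {F : MvPolynomial (Fin (N + 1)) K} (hF : F ∈ symbolicPower I m) (hF0 : F ≠ 0) :
    m * alphaDeg I ≤ N * F.totalDegree := by
  rcases Nat.eq_zero_or_pos (alphaDeg I) with hα | hα
  · simp [hα]
  have hle := hI.le_pow_alphaDeg
  by_cases hP : ∃ P ∈ associatedPrimes _ (MvPolynomial (Fin (N + 1)) K ⧸ I),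
      MvPolynomial.idealOfVars (Fin (N + 1)) K ≤ P
  · obtain ⟨P, hP, hPle⟩ := hP
    obtain ⟨w, hw, hwF⟩ := hF P hP
    have hw0 : MvPolynomial.constantCoeff w ≠ 0 := fun h => hw (hPle (mem_idealOfVars_iff.2 h))
    have hwF' := Ideal.pow_right_mono hle m hwF
    rw [← pow_mul] at hwF'
    have hFm := (isHomogeneousIdeal_pow_idealOfVars _).mem_of_mul_mem hw0 hwF'
    calc m * alphaDeg I = alphaDeg I * m := mul_comm _ _
      _ ≤ F.totalDegree := le_totalDegree_of_mem_pow_idealOfVars hFm hF0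
      _ ≤ N * F.totalDegree := Nat.le_mul_of_pos_left _ hN
  · push Not at hP
    obtain ⟨z, hz, hzI⟩ := exists_mem_forall_mem_of_mul_mem hP
    rw [mem_idealOfVars_iff] at hz
    obtain ⟨t, ht, htI⟩ := exists_mem_forall_mem_of_mul_mem (I := I)
      (J := Submodule.comap (LinearMap.toSpanSingleton _ _ F) (I ^ m)) fun P hP hle => by
        obtain ⟨w, hw, hwF⟩ := hF P hP
        exact hw (hle hwF)
    let := (Polynomial.aeval (R := K) z).toAlgebra
    obtain ⟨s, hs, c, g, l, hc, hg, hu⟩ := exists_reduction (C := Polynomial K)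
      (IsNoetherian.noetherian I) (exists_aeval_eq_zero_of_mvPolynomial z)
    obtain ⟨r, f, e, hf, hIf⟩ := hI.exists_eq_span
    have hmem (k : ℕ) (h) (hh : (Polynomial.aeval z c * t) ^ k * h ∈ I) : h ∈ I := by
      induction k with
      | zero => simpa using hh
      | succ k ih =>
        refine ih (htI _ (hI.mem_of_aeval_mul_mem hz hzI hc ?_))
        convert hh using 1
        ring
    have key := mul_le_mul_of_reduction (D := alphaDeg I - 1) hm hs hf hIf rfl
      (Ideal.span_le.2 (Set.range_subset_iff.2 hg)) hu ht hF0 le_rfl fun h hD hh => by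
        by_contra h0
        have := le_totalDegree_of_mem_pow_idealOfVars (hle (hmem _ h hh)) h0
        omega
    rwa [Nat.sub_add_cancel hα] at key

end Main

/-- Waldschmidt–Skoda: for a nonzero proper homogeneous ideal `I` of
`K[x_0,…,x_N]` and every `m > 0`, `α(I^(m))/m ≥ α(I)/N`. -/
theorem waldschmidt_skoda {K : Type*} [Field K] {N : ℕ}
    (I : Ideal (MvPolynomial (Fin (N + 1)) K)) (hne : I ≠ ⊥) (hproper : I ≠ ⊤)
    (hhom : IsHomogeneousIdeal I) :
    ∀ m : ℕ, 0 < m →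
      (alphaDeg (symbolicPower I m) : ℚ) / m ≥ (alphaDeg I : ℚ) / N := by
  intro m hm
  rcases Nat.eq_zero_or_pos N with rfl | hN
  · rw [Nat.cast_zero, div_zero]
    positivity
  obtain ⟨F, hF, hF0, hFd⟩ := hhom.exists_isHomogeneous_mem_symbolicPower hne m
  have h := hhom.mul_alphaDeg_le hN hm hF hF0
  rw [hFd.totalDegree hF0] at h
  rw [ge_iff_le, div_le_div_iff₀ (by positivity) (by positivity)]
  norm_cast
  linarith

end
end

section
/- (Chudnovsky) Let p_1,...,p_n ∈ P^2 be distinct K-points and let I = ∩_i I(p_i) ⊆ K[x_0,x_1,x_2]. Then for all m > 0, α(I^(m))/m ≥ (α(I)+1)/2. -/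
open MvPolynomial
open scoped LinearAlgebra.Projectivization

noncomputable section

/-- The homogeneous vanishing ideal of a point of projective `N`-space:
the ideal generated by all forms vanishing at the point. -/
def pointIdeal {K : Type*} [Field K] {N : ℕ} (q : ℙ K (Fin (N + 1) → K)) :
    Ideal (MvPolynomial (Fin (N + 1)) K) :=
  Ideal.span {f | (∃ d : ℕ, f.IsHomogeneous d) ∧ MvPolynomial.eval q.rep f = 0}

namespace MvPolynomial

lemma finrank_homogeneousSubmodule_fin_three {K : Type*} [Field K] (t : ℕ) :
    Module.finrank K (homogeneousSubmodule (Fin 3) K t) = (t + 2).choose 2 := by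
  have hset : {d : Fin 3 →₀ ℕ | d.degree = t} =
      (Finset.finsuppAntidiag (Finset.univ : Finset (Fin 3)) t : Set (Fin 3 →₀ ℕ)) := by
    ext d
    simp [Finset.mem_finsuppAntidiag, Finsupp.degree_eq_sum]
  rw [homogeneousSubmodule_eq_finsupp_supported, hset]
  change Module.finrank K (restrictSupport K _) = _
  rw [Module.finrank_eq_nat_card_basis (basisRestrictSupport K _)]
  simp only [SetLike.coe_sort_coe, Nat.card_eq_fintype_card, Fintype.card_coe,
    Finset.card_finsuppAntidiag_nat_eq_choose, Finset.card_univ, Fintype.card_fin]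
  rw [← Nat.choose_symm_add, add_comm]
  simp

instance {σ K : Type*} [Finite σ] [Field K] (t : ℕ) :
    FiniteDimensional K (homogeneousSubmodule σ K t) :=
  Module.Finite.iff_fg.mpr (homogeneousSubmodule_fg σ K t)

/-- The exponents of the monomials of degree less than `m` in two variables. -/
def lowExponents (m : ℕ) : Finset (Fin 2 →₀ ℕ) :=
  (Finset.range m).biUnion fun k => Finset.finsuppAntidiag Finset.univ k

lemma mem_lowExponents {m : ℕ} {d : Fin 2 →₀ ℕ} : d ∈ lowExponents m ↔ d.degree < m := by
  simp [lowExponents, Finset.mem_finsuppAntidiag, Finsupp.degree_eq_sum]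

lemma card_lowExponents_succ (m : ℕ) :
    (lowExponents (m + 1)).card = (lowExponents m).card + (m + 1) := by
  have h : lowExponents (m + 1) =
      lowExponents m ∪ Finset.finsuppAntidiag (Finset.univ : Finset (Fin 2)) m := by
    rw [lowExponents, Finset.range_add_one, Finset.biUnion_insert, Finset.union_comm, lowExponents]
  rw [h, Finset.card_union_of_disjoint, Finset.card_finsuppAntidiag_nat_eq_choose]
  · simp [add_comm]
  · rw [Finset.disjoint_left]
    intro d hd
    rw [mem_lowExponents] at hd
    simp only [Finset.mem_finsuppAntidiag, Finset.subset_univ, and_true,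
      ← Finsupp.degree_eq_sum]
    exact hd.ne

lemma card_lowExponents (m : ℕ) :
    (lowExponents m).card = (lowExponents (m - 1)).card + m := by
  cases m with
  | zero => simp
  | succ m => exact card_lowExponents_succ m

lemma order_coe_le_totalDegree {σ K : Type*} [Field K] {f : MvPolynomial σ K} (hf : f ≠ 0) :
    (f : MvPowerSeries σ K).order ≤ f.totalDegree := by
  obtain ⟨d, hd⟩ := ne_zero_iff.mp hf
  refine (MvPowerSeries.order_le (d := d) (by simpa using hd)).trans ?_
  exact_mod_cast le_totalDegree (mem_support_iff.mpr hd)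

lemma mem_pow_idealOfVars_iff_le_order {σ K : Type*} [Field K] {f : MvPolynomial σ K} {m : ℕ} :
    f ∈ idealOfVars σ K ^ m ↔ (m : ℕ∞) ≤ (f : MvPowerSeries σ K).order := by
  rw [mem_pow_idealOfVars_iff']
  constructor
  · intro h
    exact MvPowerSeries.nat_le_order (by simpa using h)
  · intro h x hx
    have := MvPowerSeries.coeff_of_lt_order (f := (f : MvPowerSeries σ K)) (d := x)
      (lt_of_lt_of_le (by exact_mod_cast hx) h)
    simpa using this

lemma exists_mem_pow_idealOfVars_of_mul_mem {σ K : Type*} [Field K] {f g : MvPolynomial σ K}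
    {m : ℕ} (h : f * g ∈ idealOfVars σ K ^ m) :
    ∃ i j : ℕ, i + j = m ∧ f ∈ idealOfVars σ K ^ i ∧ g ∈ idealOfVars σ K ^ j := by
  simp only [mem_pow_idealOfVars_iff_le_order] at h ⊢
  rw [coe_mul, MvPowerSeries.order_mul] at h
  rcases le_total (m : ℕ∞) (f : MvPowerSeries σ K).order with hf | hf
  · exact ⟨m, 0, by simp, hf, by simp⟩
  · obtain ⟨i, hi⟩ := ENat.ne_top_iff_exists.mp (ne_top_of_le_ne_top (by simp) hf)
    rw [← hi] at h hf ⊢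
    have him : i ≤ m := by exact_mod_cast hf
    refine ⟨i, m - i, by omega, le_rfl, ?_⟩
    cases hg : (g : MvPowerSeries σ K).order with
    | top => simp
    | coe j =>
      rw [hg] at h
      norm_cast at h ⊢
      omega

lemma IsHomogeneous.of_mul_left {σ K : Type*} [Field K] {f g : MvPolynomial σ K} {d : ℕ}
    (h : (f * g).IsHomogeneous d) (h0 : f * g ≠ 0) : f.IsHomogeneous f.totalDegree := by
  have hf : f ≠ 0 := left_ne_zero_of_mul h0
  have hg : g ≠ 0 := right_ne_zero_of_mul h0
  have hdeg := totalDegree_mul_of_isDomain hf hg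
  rw [h.totalDegree h0] at hdeg
  have hord : (d : ℕ∞) ≤ ((f * g : MvPolynomial σ K) : MvPowerSeries σ K).order := by
    refine MvPowerSeries.nat_le_order fun x hx => ?_
    rw [coeff_coe]
    exact h.coeff_eq_zero (by exact_mod_cast hx.ne)
  rw [coe_mul, MvPowerSeries.order_mul] at hord
  have hfo : (f.totalDegree : ℕ∞) ≤ (f : MvPowerSeries σ K).order := by
    by_contra! hlt
    have hgo := order_coe_le_totalDegree hg
    obtain ⟨i, hi⟩ := ENat.ne_top_iff_exists.mp hlt.ne_top
    obtain ⟨j, hj⟩ := ENat.ne_top_iff_exists.mp (ne_top_of_le_ne_top (by simp) hgo)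
    rw [← hi] at hlt hord
    rw [← hj] at hgo hord
    norm_cast at hlt hgo hord
    omega
  rw [← mem_pow_idealOfVars_iff_le_order, mem_pow_idealOfVars_iff] at hfo
  intro x hx
  have h1 := hfo x (mem_support_iff.mpr hx)
  have h2 := le_totalDegree (mem_support_iff.mpr hx)
  have h3 := congrArg (fun w : (σ →₀ ℕ) →+ ℕ => w x) (Finsupp.degree_eq_weight_one (σ := σ) (R := ℕ))
  exact h3.symm.trans (le_antisymm h2 h1)

lemma mem_idealOfVars_iff {σ K : Type*} [Field K] {f : MvPolynomial σ K} :
    f ∈ idealOfVars σ K ↔ constantCoeff f = 0 := by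
  rw [← pow_one (idealOfVars σ K), mem_pow_idealOfVars_iff', constantCoeff_eq]
  simp [Finsupp.degree_eq_zero_iff]

/-- An affine chart of the plane centred at the point `v`, together with linear forms
restricting to `1` and to the two affine coordinates. -/
structure AffineChart {K : Type*} [Field K] (v : Fin 3 → K) where
  /-- Restriction of polynomials to the chart. -/
  toAlgHom : MvPolynomial (Fin 3) K →ₐ[K] MvPolynomial (Fin 2) K
  constantCoeff_toAlgHom : ∀ f, constantCoeff (toAlgHom f) = eval v f
  /-- The form defining the line at infinity. -/
  unitForm : MvPolynomial (Fin 3) K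
  /-- The forms restricting to the affine coordinates. -/
  coordForm : Fin 2 → MvPolynomial (Fin 3) K
  isHomogeneous_unitForm : unitForm.IsHomogeneous 1
  isHomogeneous_coordForm : ∀ i, (coordForm i).IsHomogeneous 1
  toAlgHom_unitForm : toAlgHom unitForm = 1
  toAlgHom_coordForm : ∀ i, toAlgHom (coordForm i) = X i

namespace AffineChart

variable {K : Type*} [Field K]

lemma nonempty_of_ne_zero {v : Fin 3 → K} (hv : v ≠ 0) : Nonempty (AffineChart v) := by
  obtain ⟨i, hi⟩ := Function.ne_iff.mp hv
  have hi : v i ≠ 0 := hi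
  have hC : (C (v i)⁻¹ * C (v i) : MvPolynomial (Fin 2) K) = 1 := by
    rw [← C_mul, inv_mul_cancel₀ hi, C_1]
  let w : Fin 2 → Fin 3 := ![i + 1, i + 2]
  have hw : ∀ j, w j ≠ i := by
    intro j
    fin_cases j <;> simp [w]
  have hwinj : Function.Injective w := by
    intro j k
    fin_cases j <;> fin_cases k <;> simp [w]
  let θ : MvPolynomial (Fin 3) K →ₐ[K] MvPolynomial (Fin 2) K :=
    aeval fun r => C (v r) + ∑ j, if r = w j then X j else 0
  have hθi : θ (X i) = C (v i) := by
    simp [θ, fun j => (hw j).symm]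
  have hθw : ∀ j, θ (X (w j)) = C (v (w j)) + X j := by
    intro j
    simp only [θ, aeval_X, hwinj.eq_iff, Fin.sum_univ_two]
    fin_cases j <;> simp
  refine ⟨⟨θ, fun f => ?_, C (v i)⁻¹ * X i, fun j => X (w j) - C (v (w j) * (v i)⁻¹) * X i,
    isHomogeneous_C_mul_X _ _,
    fun j => (isHomogeneous_X _ _).sub (isHomogeneous_C_mul_X _ _), ?_, fun j => ?_⟩⟩
  · have h : (constantCoeff.comp θ.toRingHom) = eval v := by
      ext r
      · simp
      · simp [θ, apply_ite constantCoeff]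
    exact RingHom.congr_fun h f
  · rw [map_mul, hθi, algHom_C, algebraMap_eq, hC]
  · rw [map_sub, map_mul, hθi, hθw, algHom_C, algebraMap_eq, C_mul, mul_assoc, hC]
    ring

variable {v : Fin 3 → K} (θ : AffineChart v)

lemma toAlgHom_mem_idealOfVars_iff {f : MvPolynomial (Fin 3) K} :
    θ.toAlgHom f ∈ idealOfVars (Fin 2) K ↔ eval v f = 0 := by
  rw [mem_idealOfVars_iff, θ.constantCoeff_toAlgHom]

lemma eval_coordForm (i : Fin 2) : eval v (θ.coordForm i) = 0 := by
  rw [← θ.constantCoeff_toAlgHom, θ.toAlgHom_coordForm, constantCoeff_X]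

lemma coordForm_ne_zero (i : Fin 2) : θ.coordForm i ≠ 0 := by
  intro h
  have := θ.toAlgHom_coordForm i
  rw [h, map_zero] at this
  exact X_ne_zero i this.symm

/-- Polynomials of degree at most `t` on the chart homogenize to forms of degree `t`. -/
lemma exists_isHomogeneous_toAlgHom_eq {t : ℕ} {g : MvPolynomial (Fin 2) K}
    (hg : g.totalDegree ≤ t) :
    ∃ f : MvPolynomial (Fin 3) K, f.IsHomogeneous t ∧ θ.toAlgHom f = g := by
  refine ⟨∑ s ∈ g.support, C (coeff s g) *
    (θ.unitForm ^ (t - s.degree) * ∏ i, θ.coordForm i ^ s i), ?_, ?_⟩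
  · refine IsHomogeneous.sum _ _ _ fun s hs => ?_
    have hst : s.degree ≤ t := (le_totalDegree hs).trans hg
    have h1 := θ.isHomogeneous_unitForm.pow (t - s.degree)
    have h2 := IsHomogeneous.prod Finset.univ (fun i => θ.coordForm i ^ s i) (fun i => 1 * s i)
      fun i _ => (θ.isHomogeneous_coordForm i).pow (s i)
    have h3 := (h1.mul h2).C_mul (coeff s g)
    convert h3 using 1
    simp only [one_mul, ← Finsupp.degree_eq_sum]
    omega
  · conv_rhs => rw [g.as_sum]
    rw [map_sum]
    refine Finset.sum_congr rfl fun s _ => ?_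
    rw [map_mul, map_mul, map_pow, map_prod, θ.toAlgHom_unitForm, algHom_C, monomial_eq,
      Finsupp.prod_fintype _ _ (by simp)]
    simp [θ.toAlgHom_coordForm]

end AffineChart

section Jets

variable {K ι : Type*} [Field K] {v : ι → Fin 3 → K}

/-- The tuple of Taylor coefficients of order less than `m i` at the points `v i`. -/
def jets (θ : ∀ i, AffineChart (v i)) (m : ι → ℕ) :
    MvPolynomial (Fin 3) K →ₗ[K] ((Σ i, lowExponents (m i)) → K) :=
  LinearMap.pi fun x => lcoeff K x.2.1 ∘ₗ (θ x.1).toAlgHom.toLinearMap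

lemma jets_apply (θ : ∀ i, AffineChart (v i)) (m : ι → ℕ) (f : MvPolynomial (Fin 3) K)
    (x : Σ i, lowExponents (m i)) : jets θ m f x = coeff x.2.1 ((θ x.1).toAlgHom f) := rfl

lemma jets_eq_zero_iff (θ : ∀ i, AffineChart (v i)) (m : ι → ℕ) (f : MvPolynomial (Fin 3) K) :
    jets θ m f = 0 ↔ ∀ i, (θ i).toAlgHom f ∈ idealOfVars (Fin 2) K ^ m i := by
  simp only [mem_pow_idealOfVars_iff', ← mem_lowExponents]
  exact ⟨fun h i x hx => congrFun h ⟨i, x, hx⟩, fun h => by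
    ext ⟨i, x, hx⟩
    exact h i x hx⟩

lemma finrank_jets [Fintype ι] (m : ι → ℕ) :
    Module.finrank K ((Σ i, lowExponents (m i)) → K) = ∑ i, (lowExponents (m i)).card := by
  simp

/-- Forms of large degree have arbitrary jets at points which can be separated by forms. -/
lemma exists_map_jets_eq_top [Fintype ι] (θ : ∀ i, AffineChart (v i)) (m : ι → ℕ)
    (hsep : ∀ i, ∃ (e : ℕ) (u : MvPolynomial (Fin 3) K), u.IsHomogeneous e ∧ eval (v i) u ≠ 0 ∧
      ∀ j, j ≠ i → eval (v j) u = 0) :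
    ∃ T₀, ∀ T, T₀ ≤ T → (homogeneousSubmodule (Fin 3) K T).map (jets θ m) = ⊤ := by
  classical
  have key : ∀ x : Σ i, lowExponents (m i), ∃ T₀, ∀ T, T₀ ≤ T →
      ∃ f : MvPolynomial (Fin 3) K, f.IsHomogeneous T ∧ jets θ m f = Pi.single x 1 := by
    rintro ⟨i, s, hs⟩
    obtain ⟨e, u, hu, hui, huj⟩ := hsep i
    set M := ∑ j, m j
    set b := (θ i).toAlgHom (u ^ M)
    have hc : constantCoeff b ≠ 0 := by
      rw [(θ i).constantCoeff_toAlgHom, map_pow]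
      exact pow_ne_zero _ hui
    set n := 1 - C (constantCoeff b)⁻¹ * b with hn
    have hnmem : n ∈ idealOfVars (Fin 2) K := by
      rw [mem_idealOfVars_iff]
      simp [hn, hc]
    obtain ⟨q, hq⟩ := sub_dvd_pow_sub_pow 1 n (m i)
    set g := C (constantCoeff b)⁻¹ * q * monomial s (1 : K)
    have hbg : b * g = monomial s 1 - n ^ m i * monomial s 1 := by
      have h1 : 1 - n = C (constantCoeff b)⁻¹ * b := by rw [hn]; ring
      rw [one_pow, h1] at hq
      linear_combination (-monomial s (1 : K)) * hq
    refine ⟨e * M + g.totalDegree, fun T hT => ?_⟩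
    obtain ⟨f, hf, hfg⟩ := (θ i).exists_isHomogeneous_toAlgHom_eq (t := T - e * M) (g := g)
      (by omega)
    refine ⟨u ^ M * f, ?_, ?_⟩
    · convert (hu.pow M).mul hf using 1
      omega
    · funext ⟨j, s', hs'⟩
      rw [jets_apply]
      rw [mem_lowExponents] at hs'
      by_cases hji : j = i
      · subst hji
        have h0 : coeff s' (n ^ m j * monomial s 1) = 0 :=
          (mem_pow_idealOfVars_iff' _ _).mp
            (Ideal.mul_mem_right _ _ (Ideal.pow_mem_pow hnmem _)) _ hs'
        rw [map_mul, hfg, hbg, coeff_sub, h0, sub_zero, coeff_monomial]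
        by_cases hss : s = s'
        · subst hss
          simp
        · rw [if_neg hss, Pi.single_eq_of_ne]
          simpa using fun h => hss h.symm
      · rw [Pi.single_eq_of_ne (by simp [hji])]
        refine (mem_pow_idealOfVars_iff' _ _).mp ?_ _ hs'
        rw [map_mul, map_pow]
        refine Ideal.mul_mem_right _ _ (Ideal.pow_le_pow_right
          (Finset.single_le_sum (fun _ _ => Nat.zero_le _) (Finset.mem_univ j))
          (Ideal.pow_mem_pow ?_ _))
        rw [(θ j).toAlgHom_mem_idealOfVars_iff]
        exact huj j hji
  choose T₀ hT₀ using key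
  refine ⟨Finset.univ.sup T₀, fun T hT => ?_⟩
  rw [eq_top_iff, ← (Pi.basisFun K _).span_eq, Submodule.span_le]
  rintro _ ⟨x, rfl⟩
  obtain ⟨f, hf, hfx⟩ := hT₀ x T ((Finset.le_sup (Finset.mem_univ x)).trans hT)
  exact ⟨f, hf, by rw [hfx, Pi.basisFun_apply]⟩

end Jets

lemma _root_.Submodule.finrank_map_add_finrank_inf_ker {K V W : Type*} [Field K] [AddCommGroup V]
    [Module K V] [AddCommGroup W] [Module K W] (f : V →ₗ[K] W) (N : Submodule K V)
    [FiniteDimensional K N] :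
    Module.finrank K (N.map f) + Module.finrank K (N ⊓ LinearMap.ker f : Submodule K V) =
      Module.finrank K N := by
  have h := LinearMap.finrank_range_add_finrank_ker (f.domRestrict N)
  rw [LinearMap.range_domRestrict] at h
  rw [← h, ← Submodule.map_comap_subtype, Submodule.finrank_map_subtype_eq, LinearMap.domRestrict,
    LinearMap.ker_comp]

/-- Bezout's inequality for a prime form with multiplicity `m i` at `v i` and a form through the
points `v i` that it does not divide. -/
theorem sum_le_mul_of_prime {K ι : Type*} [Field K] [Fintype ι] {v : ι → Fin 3 → K}
    (θ : ∀ i, AffineChart (v i)) (m : ι → ℕ)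
    (hsep : ∀ i, ∃ (e : ℕ) (u : MvPolynomial (Fin 3) K), u.IsHomogeneous e ∧ eval (v i) u ≠ 0 ∧
      ∀ j, j ≠ i → eval (v j) u = 0)
    {F G : MvPolynomial (Fin 3) K} {d a : ℕ} (hFd : F.IsHomogeneous d) (hGa : G.IsHomogeneous a)
    (hF : Prime F) (hFG : ¬ F ∣ G) (hFm : ∀ i, (θ i).toAlgHom F ∈ idealOfVars (Fin 2) K ^ m i)
    (hGv : ∀ i, eval (v i) G = 0) : ∑ i, m i ≤ d * a := by
  have hG0 : G ≠ 0 := by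
    rintro rfl
    exact hFG (dvd_zero F)
  obtain ⟨t, ht⟩ := exists_map_jets_eq_top θ m hsep
  let V := homogeneousSubmodule (Fin 3) K
  let UF := (V (t + a)).map (LinearMap.mulLeft K F)
  let UG := (V (t + d)).map (LinearMap.mulLeft K G)
  have hUF : UF ≤ V (t + a + d) := by
    rintro _ ⟨f, hf, rfl⟩
    have := hFd.mul hf
    rwa [add_comm] at this
  have hUG : UG ≤ V (t + a + d) := by
    rintro _ ⟨f, hf, rfl⟩
    have := hGa.mul hf
    rwa [show a + (t + d) = t + a + d by ring] at this
  have hUFr : Module.finrank K UF = (t + a + 2).choose 2 := by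
    rw [← finrank_homogeneousSubmodule_fin_three (K := K)]
    refine (Submodule.equivMapOfInjective _ ?_ _).finrank_eq.symm
    exact mul_right_injective₀ hF.ne_zero
  have hUGr : Module.finrank K UG = (t + d + 2).choose 2 := by
    rw [← finrank_homogeneousSubmodule_fin_three (K := K)]
    refine (Submodule.equivMapOfInjective _ ?_ _).finrank_eq.symm
    exact mul_right_injective₀ hG0
  have hinf : Module.finrank K (UF ⊓ UG : Submodule K _) ≤ (t + 2).choose 2 := by
    have hle : UF ⊓ UG ≤ (V t).map (LinearMap.mulLeft K (G * F)) := by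
      rintro _ ⟨⟨f, hf, rfl⟩, ⟨g, hg, hfg⟩⟩
      simp only [LinearMap.mulLeft_apply] at hfg ⊢
      obtain ⟨g', rfl⟩ := (hF.dvd_or_dvd (Dvd.intro f hfg.symm)).resolve_left hFG
      refine ⟨g', ?_, by rw [LinearMap.mulLeft_apply, ← hfg, mul_assoc]⟩
      by_cases hg0 : g' = 0
      · rw [hg0]
        exact zero_mem _
      have hne : F * g' ≠ 0 := mul_ne_zero hF.ne_zero hg0
      have hg : (F * g').IsHomogeneous (t + d) := hg
      have h1 : g'.IsHomogeneous g'.totalDegree := by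
        rw [mul_comm] at hg hne
        exact hg.of_mul_left hne
      have h2 := hg.inj_right (hFd.mul h1) hne
      rwa [show g'.totalDegree = t by omega] at h1
    refine (Submodule.finrank_mono hle).trans ((Submodule.finrank_map_le _ _).trans ?_)
    rw [finrank_homogeneousSubmodule_fin_three]
  have hsup := Submodule.finrank_sup_add_finrank_inf_eq UF UG
  have hU : Module.finrank K ((UF ⊔ UG).map (jets θ m)) ≤ ∑ i, (lowExponents (m i - 1)).card := by
    have hF0 : UF.map (jets θ m) = ⊥ := by
      rw [eq_bot_iff]
      rintro _ ⟨_, ⟨f, hf, rfl⟩, rfl⟩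
      rw [Submodule.mem_bot, jets_eq_zero_iff]
      intro i
      rw [LinearMap.mulLeft_apply, map_mul]
      exact Ideal.mul_mem_right _ _ (hFm i)
    have hker : LinearMap.ker (jets θ fun i => m i - 1) ≤
        LinearMap.ker (jets θ m ∘ₗ LinearMap.mulLeft K G) := by
      intro f hf
      rw [LinearMap.mem_ker, jets_eq_zero_iff] at hf
      rw [LinearMap.mem_ker, LinearMap.comp_apply, jets_eq_zero_iff]
      intro i
      rw [LinearMap.mulLeft_apply, map_mul]
      have h1 : (θ i).toAlgHom G ∈ idealOfVars (Fin 2) K :=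
        (θ i).toAlgHom_mem_idealOfVars_iff.mpr (hGv i)
      have h2 := Ideal.mul_mem_mul h1 (hf i)
      rw [← pow_succ'] at h2
      exact Ideal.pow_le_pow_right (by omega) h2
    rw [Submodule.map_sup, hF0, bot_sup_eq, ← Submodule.map_comp, ← finrank_jets (K := K)]
    refine le_trans ?_ (Submodule.finrank_le ((V (t + d)).map (jets θ fun i => m i - 1)))
    have h1 := Submodule.finrank_map_add_finrank_inf_ker
      (jets θ m ∘ₗ LinearMap.mulLeft K G) (V (t + d))
    have h2 := Submodule.finrank_map_add_finrank_inf_ker (jets θ fun i => m i - 1) (V (t + d))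
    have h3 := Submodule.finrank_mono (inf_le_inf_left (V (t + d)) hker)
    omega
  have hV := Submodule.finrank_map_add_finrank_inf_ker (jets θ m) (V (t + a + d))
  have hUV := Submodule.finrank_map_add_finrank_inf_ker (jets θ m) (UF ⊔ UG)
  have hmono := Submodule.finrank_mono
    (inf_le_inf_right (LinearMap.ker (jets θ m)) (sup_le hUF hUG))
  rw [ht _ (by omega), finrank_top, finrank_jets, finrank_homogeneousSubmodule_fin_three,
    Finset.sum_congr rfl fun i _ => card_lowExponents (m i), Finset.sum_add_distrib] at hV
  have hchoose : ∀ s : ℕ, 2 * (s + 2).choose 2 = (s + 2) * (s + 1) := fun s => by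
    rw [Nat.choose_two_right, Nat.mul_div_cancel' (Nat.even_mul_pred_self _).two_dvd]
    rfl
  have c1 := hchoose t
  have c2 := hchoose (t + a)
  have c3 := hchoose (t + d)
  have c4 := hchoose (t + a + d)
  nlinarith

/-- Bezout's inequality against a linear system of forms without common components. -/
theorem sum_le_mul_of_forall_prime {K ι : Type*} [Field K] [Fintype ι] {v : ι → Fin 3 → K}
    (θ : ∀ i, AffineChart (v i))
    (hsep : ∀ i, ∃ (e : ℕ) (u : MvPolynomial (Fin 3) K), u.IsHomogeneous e ∧ eval (v i) u ≠ 0 ∧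
      ∀ j, j ≠ i → eval (v j) u = 0) {a : ℕ}
    (hbase : ∀ H : MvPolynomial (Fin 3) K, Prime H → ∃ G : MvPolynomial (Fin 3) K,
      G.IsHomogeneous a ∧ (∀ i, eval (v i) G = 0) ∧ ¬ H ∣ G)
    {F : MvPolynomial (Fin 3) K} (hF : F ≠ 0) {d : ℕ} (hFd : F.IsHomogeneous d) {m : ι → ℕ}
    (hFm : ∀ i, (θ i).toAlgHom F ∈ idealOfVars (Fin 2) K ^ m i) : ∑ i, m i ≤ d * a := by
  induction F using UniqueFactorizationMonoid.induction_on_prime generalizing d m with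
  | h₁ => exact absurd rfl hF
  | h₂ F hu =>
    obtain ⟨c, hc, rfl⟩ := isUnit_iff_eq_C_of_isReduced.mp hu
    have hm : ∀ i, m i = 0 := fun i => by
      have := hFm i
      rw [algHom_C, algebraMap_eq, C_mem_pow_idealOfVars_iff] at this
      exact this.resolve_left hc.ne_zero
    simp [hm]
  | h₃ F H hF0 hH ih =>
    have h1 : H.IsHomogeneous H.totalDegree := hFd.of_mul_left hF
    have h2 : F.IsHomogeneous F.totalDegree := by
      rw [mul_comm] at hFd hF
      exact hFd.of_mul_left hF
    have hd := hFd.inj_right (h1.mul h2) hF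
    simp only [map_mul] at hFm
    choose i j hij hi hj using fun x => exists_mem_pow_idealOfVars_of_mul_mem (hFm x)
    obtain ⟨G, hGa, hGv, hHG⟩ := hbase H hH
    have b1 := sum_le_mul_of_prime θ i hsep h1 hGa hH hHG hi hGv
    have b2 := ih hF0 h2 hj
    rw [Finset.sum_congr rfl fun x _ => (hij x).symm, Finset.sum_add_distrib, hd, add_mul]
    exact add_le_add b1 b2

lemma isUnit_of_dvd_linear {K : Type*} [Field K] {H : MvPolynomial (Fin 3) K}
    {l : Fin 2 → MvPolynomial (Fin 3) K} (hl : ∀ i, (l i).IsHomogeneous 1) (hH : ∀ i, H ∣ l i)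
    (φ : MvPolynomial (Fin 3) K →ₐ[K] MvPolynomial (Fin 2) K) (hφ : ∀ i, φ (l i) = X i) :
    IsUnit H := by
  choose q hq using hH
  have hl0 : ∀ i, l i ≠ 0 := fun i h => by
    have := hφ i
    rw [h, map_zero] at this
    exact X_ne_zero i this.symm
  have hH0 : H ≠ 0 := fun h => hl0 0 (by rw [hq, h, zero_mul])
  have hq0 : ∀ i, q i ≠ 0 := fun i h => hl0 i (by rw [hq, h, mul_zero])
  have hdeg : ∀ i, H.totalDegree + (q i).totalDegree = 1 := fun i => by
    rw [← totalDegree_mul_of_isDomain hH0 (hq0 i), ← hq, (hl i).totalDegree (hl0 i)]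
  by_cases h0 : H.totalDegree = 0
  · rw [totalDegree_eq_zero_iff_eq_C] at h0
    rw [h0]
    refine IsUnit.map C (isUnit_iff_ne_zero.mpr fun h => hH0 ?_)
    rw [h0, h, C_0]
  · exfalso
    have hc : ∀ i, ∃ c, q i = C c := fun i => ⟨_, totalDegree_eq_zero_iff_eq_C.mp (by
      have := hdeg i
      omega)⟩
    choose c hc using hc
    have hrel : C (c 1) * X 0 = (C (c 0) * X 1 : MvPolynomial (Fin 2) K) := by
      rw [← hφ 0, ← hφ 1, hq 0, hq 1, map_mul, map_mul, hc 0, hc 1, algHom_C, algHom_C,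
        algebraMap_eq]
      ring
    have hc1 : c 1 = 0 := by
      have := congrArg (eval ![(1 : K), 0]) hrel
      simpa using this
    exact hq0 1 (by rw [hc, hc1, C_0])

/-- If no form of degree `t` vanishes at all the points, then some of the points impose
independent conditions on forms of degree `t` and still have that property. -/
lemma exists_separated_subset {K ι : Type*} [Field K] [Fintype ι] (v : ι → Fin 3 → K) (t : ℕ)
    (h : ∀ f : MvPolynomial (Fin 3) K, f.IsHomogeneous t → (∀ i, eval (v i) f = 0) → f = 0) :
    ∃ S : Finset ι,
      (∀ f : MvPolynomial (Fin 3) K, f.IsHomogeneous t → (∀ i : S, eval (v i) f = 0) → f = 0) ∧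
      (∀ i : S, ∃ u : MvPolynomial (Fin 3) K, u.IsHomogeneous t ∧ eval (v i) u ≠ 0 ∧
        ∀ j : S, j ≠ i → eval (v j) u = 0) ∧ (t + 2).choose 2 ≤ S.card := by
  classical
  let P : Finset ι → Prop := fun S =>
    ∀ f : MvPolynomial (Fin 3) K, f.IsHomogeneous t → (∀ i : S, eval (v i) f = 0) → f = 0
  obtain ⟨S, hS⟩ := exists_minimal_of_wellFoundedLT P
    ⟨Finset.univ, fun f hf hv => h f hf fun i => hv ⟨i, Finset.mem_univ i⟩⟩
  refine ⟨S, hS.prop, fun i => ?_, ?_⟩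
  · have hi : ¬ P (S.erase i) := fun hP =>
      Finset.notMem_erase (i : ι) S (hS.le_of_le hP (Finset.erase_subset _ _) i.2)
    simp only [P, not_forall] at hi
    obtain ⟨u, hu, huv, hu0⟩ := hi
    have hj : ∀ j : S, j ≠ i → eval (v j) u = 0 := fun j hj =>
      huv ⟨j, Finset.mem_erase.mpr ⟨fun h => hj (Subtype.ext h), j.2⟩⟩
    refine ⟨u, hu, fun hui => hu0 (hS.prop u hu fun j => ?_), hj⟩
    by_cases hji : j = i
    · rw [hji, hui]
    · exact hj j hji
  · let E : homogeneousSubmodule (Fin 3) K t →ₗ[K] (S → K) :=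
      LinearMap.pi fun i => (aeval (v i)).toLinearMap ∘ₗ Submodule.subtype _
    have hE : Function.Injective E := by
      rw [injective_iff_map_eq_zero]
      rintro ⟨f, hf⟩ hEf
      refine Subtype.ext (hS.prop f hf fun i => ?_)
      simpa [E, aeval_eq_eval] using congrFun hEf i
    have := LinearMap.finrank_le_finrank_of_injective hE
    rwa [finrank_homogeneousSubmodule_fin_three, Module.finrank_fintype_fun_eq_card,
      Fintype.card_coe] at this

/-- Forms of degree `t + 1` through points imposing independent conditions on forms of degree `t`,
and not lying on such a form, have no common component. -/
lemma exists_not_dvd_of_prime {K ι : Type*} [Field K] [Fintype ι] {v : ι → Fin 3 → K}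
    (θ : ∀ i, AffineChart (v i)) {t : ℕ}
    (h : ∀ f : MvPolynomial (Fin 3) K, f.IsHomogeneous t → (∀ i, eval (v i) f = 0) → f = 0)
    (hsep : ∀ i, ∃ u : MvPolynomial (Fin 3) K, u.IsHomogeneous t ∧ eval (v i) u ≠ 0 ∧
      ∀ j, j ≠ i → eval (v j) u = 0)
    {H : MvPolynomial (Fin 3) K} (hH : Prime H) :
    ∃ G : MvPolynomial (Fin 3) K,
      G.IsHomogeneous (t + 1) ∧ (∀ i, eval (v i) G = 0) ∧ ¬ H ∣ G := by
  classical
  by_contra! hcon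
  choose u hu hui huj using hsep
  have hdvd : ∀ i, H ∣ u i := fun i => by
    by_contra hnd
    refine hH.not_isUnit (isUnit_of_dvd_linear (θ i).isHomogeneous_coordForm (fun k => ?_)
      (θ i).toAlgHom (θ i).toAlgHom_coordForm)
    refine (hH.dvd_or_dvd (hcon (u i * (θ i).coordForm k)
      ((hu i).mul ((θ i).isHomogeneous_coordForm k)) fun j => ?_)).resolve_left hnd
    rw [map_mul]
    by_cases hji : j = i
    · subst hji
      rw [(θ j).eval_coordForm, mul_zero]
    · rw [huj i j hji, zero_mul]
  have hall : ∀ f : MvPolynomial (Fin 3) K, f.IsHomogeneous t → H ∣ f := fun f hf => by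
    have hsum : f - ∑ i, C (eval (v i) f / eval (v i) (u i)) * u i = 0 := by
      refine h _ (hf.sub (IsHomogeneous.sum _ _ _ fun i _ => (hu i).C_mul _)) fun j => ?_
      rw [map_sub, map_sum, Finset.sum_eq_single j]
      · simp [div_mul_cancel₀ _ (hui j)]
      · intro i _ hij
        rw [map_mul, huj i j hij.symm, mul_zero]
      · simp
    rw [sub_eq_zero.mp hsum]
    exact Finset.dvd_sum fun i _ => (hdvd i).mul_left _
  refine hH.not_isUnit (isUnit_of_dvd_linear (l := ![X 0, X 1]) (fun i => ?_) (fun i => ?_)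
    (aeval ![X 0, X 1, 0]) (fun i => ?_))
  · fin_cases i <;> exact isHomogeneous_X _ _
  · fin_cases i
    · exact hH.dvd_of_dvd_pow (hall _ (isHomogeneous_X_pow 0 t))
    · exact hH.dvd_of_dvd_pow (hall _ (isHomogeneous_X_pow 1 t))
  · fin_cases i <;> simp

lemma map_mem_pow_idealOfVars_of_mem {K : Type*} [Field K] {q : ℙ K (Fin (2 + 1) → K)}
    (θ : AffineChart q.rep) {m : ℕ} {f : MvPolynomial (Fin 3) K} (hf : f ∈ pointIdeal q ^ m) :
    θ.toAlgHom f ∈ idealOfVars (Fin 2) K ^ m := by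
  have h : pointIdeal q ≤ (idealOfVars (Fin 2) K).comap θ.toAlgHom := by
    rw [pointIdeal, Ideal.span_le]
    rintro g ⟨-, hg⟩
    exact θ.toAlgHom_mem_idealOfVars_iff.mpr hg
  exact Ideal.le_comap_pow _ m (Ideal.pow_right_mono h m hf)

end MvPolynomial

/-- Chudnovsky: for the radical ideal `I` of distinct points of `ℙ²`,
`α(I^(m))/m ≥ (α(I)+1)/2` for all `m > 0`. -/
theorem chudnovsky {K : Type*} [Field K] {n : ℕ} (hn : 0 < n)
    (p : Fin n → ℙ K (Fin (2 + 1) → K)) (hinj : Function.Injective p) :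
    ∀ m : ℕ, 0 < m →
      (alphaDeg (⨅ i, (pointIdeal (p i)) ^ m) : ℚ) / m ≥
        ((alphaDeg (⨅ i, pointIdeal (p i)) : ℚ) + 1) / 2 := by
  intro m hm
  have θ : ∀ i, AffineChart (p i).rep := fun i =>
    (AffineChart.nonempty_of_ne_zero (p i).rep_nonzero).some
  have hne : {d : ℕ | ∃ f ∈ ⨅ i, pointIdeal (p i) ^ m,
      f ≠ 0 ∧ MvPolynomial.IsHomogeneous f d}.Nonempty := by
    refine ⟨∑ _i : Fin n, 1 * m, ∏ i, (θ i).coordForm 0 ^ m, ?_, ?_, ?_⟩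
    · refine Ideal.mem_iInf.mpr fun i => Ideal.mem_of_dvd _
        (Finset.dvd_prod_of_mem (fun i => (θ i).coordForm 0 ^ m) (Finset.mem_univ i)) ?_
      have hi : (θ i).coordForm 0 ∈ pointIdeal (p i) := Ideal.subset_span
        ⟨⟨1, (θ i).isHomogeneous_coordForm 0⟩, (θ i).eval_coordForm 0⟩
      exact Ideal.pow_mem_pow hi m
    · exact Finset.prod_ne_zero_iff.mpr fun i _ => pow_ne_zero _ ((θ i).coordForm_ne_zero 0)
    · exact IsHomogeneous.prod _ _ _ fun i _ => ((θ i).isHomogeneous_coordForm 0).pow m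
  obtain ⟨F, hFI, hF0, hFd⟩ := Nat.sInf_mem hne
  change F.IsHomogeneous (alphaDeg (⨅ i, pointIdeal (p i) ^ m)) at hFd
  set d := alphaDeg (⨅ i, pointIdeal (p i) ^ m)
  have hFm : ∀ i, (θ i).toAlgHom F ∈ idealOfVars (Fin 2) K ^ m := fun i =>
    map_mem_pow_idealOfVars_of_mem (θ i) (Ideal.mem_iInf.mp hFI i)
  have hm' : (0 : ℚ) < m := by exact_mod_cast hm
  have hlow : ∀ f : MvPolynomial (Fin 3) K, ∀ t < alphaDeg (⨅ i, pointIdeal (p i)),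
      f.IsHomogeneous t → (∀ i, eval (p i).rep f = 0) → f = 0 := fun f t ht hf hv => by
    by_contra hf0
    exact Nat.notMem_of_lt_sInf ht
      ⟨f, Ideal.mem_iInf.mpr fun i => Ideal.subset_span ⟨⟨t, hf⟩, hv i⟩, hf0, hf⟩
  suffices hmain : m * (alphaDeg (⨅ i, pointIdeal (p i)) + 1) ≤ 2 * d by
    rw [ge_iff_le, div_le_div_iff₀ two_pos hm']
    have : (m * (alphaDeg (⨅ i, pointIdeal (p i)) + 1) : ℚ) ≤ 2 * d := by exact_mod_cast hmain
    linarith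
  cases ha : alphaDeg (⨅ i, pointIdeal (p i)) with
  | zero =>
    have hI : (⨅ i, pointIdeal (p i) ^ m) ≤ ⨅ i, pointIdeal (p i) :=
      iInf_mono fun i => Ideal.pow_le_self hm.ne'
    obtain ⟨f, hfI, hf0, hf⟩ := Nat.sInf_mem
      (s := {d : ℕ | ∃ f ∈ ⨅ i, pointIdeal (p i), f ≠ 0 ∧ MvPolynomial.IsHomogeneous f d})
      ⟨d, F, hI hFI, hF0, hFd⟩
    change f.IsHomogeneous (alphaDeg (⨅ i, pointIdeal (p i))) at hf
    rw [ha, ← totalDegree_zero_iff_isHomogeneous, totalDegree_eq_zero_iff_eq_C] at hf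
    have h1 := map_mem_pow_idealOfVars_of_mem (θ ⟨0, hn⟩) (m := 1) (f := f)
      (by rw [pow_one]; exact Ideal.mem_iInf.mp hfI _)
    rw [pow_one, AffineChart.toAlgHom_mem_idealOfVars_iff, hf, eval_C] at h1
    rw [h1, C_0] at hf
    exact absurd hf hf0
  | succ t =>
    obtain ⟨S, hS, hsep, hcard⟩ := exists_separated_subset (fun i => (p i).rep) t
      fun f => hlow f t (by omega)
    have key := sum_le_mul_of_forall_prime (fun i : S => θ i)
      (fun i => ⟨t, hsep i⟩)
      (fun H hH => exists_not_dvd_of_prime (fun i : S => θ i) hS hsep hH) hF0 hFd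
      (m := fun _ => m) (fun i => hFm i)
    simp only [Finset.sum_const, Finset.card_univ, Fintype.card_coe, smul_eq_mul] at key
    have h2 : 2 * (t + 2).choose 2 = (t + 2) * (t + 1) := by
      rw [Nat.choose_two_right, Nat.mul_div_cancel' (Nat.even_mul_pred_self _).two_dvd]
      rfl
    have h3 := Nat.mul_le_mul_right m hcard
    have h4 : (m * (t + 1 + 1)) * (t + 1) ≤ (2 * d) * (t + 1) := by nlinarith
    exact Nat.le_of_mul_le_mul_right h4 (Nat.succ_pos t)

end
end

section
/- Let p_1,...,p_n ∈ P^N be distinct K-points and let I = ∩_i I(p_i) ⊆ K[x_0,...,x_N]. If I^(Nr) ⊆ M^{r(N-1)} I^r holds for all r ≥ 1, where M = (x_0,...,x_N), then α(I^(m))/m ≥ (α(I)+N-1)/N holds for all m ≥ 1. -/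
open MvPolynomial
open scoped LinearAlgebra.Projectivization

noncomputable section

attribute [local instance] MvPolynomial.gradedAlgebra

theorem alphaDeg_le {σ K : Type*} [CommSemiring K] {J : Ideal (MvPolynomial σ K)}
    {f : MvPolynomial σ K} {d : ℕ} (hf : f ∈ J) (hf0 : f ≠ 0) (hd : f.IsHomogeneous d) :
    alphaDeg J ≤ d :=
  Nat.sInf_le ⟨f, hf, hf0, hd⟩

theorem isHomogeneous_pointIdeal {K : Type*} [Field K] {N : ℕ}
    (q : ℙ K (Fin (N + 1) → K)) :
    (pointIdeal q).IsHomogeneous (homogeneousSubmodule (Fin (N + 1)) K) := by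
  refine Ideal.homogeneous_span _ _ ?_
  rintro f ⟨⟨d, hd⟩, -⟩
  exact ⟨d, hd⟩

/-- A homogeneous ideal lies in the `α`-th power of the ideal of the variables. -/
theorem le_idealOfVars_pow_alphaDeg {σ K : Type*} [CommRing K]
    {J : Ideal (MvPolynomial σ K)} (hJ : J.IsHomogeneous (homogeneousSubmodule σ K)) :
    J ≤ idealOfVars σ K ^ alphaDeg J := by
  intro f hf
  rw [mem_pow_idealOfVars_iff]
  intro x hx
  refine alphaDeg_le (homogeneousComponent_mem_of_mem hJ hf x.degree) ?_
    (homogeneousComponent_isHomogeneous _ _)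
  refine ne_zero_iff.mpr ⟨x, ?_⟩
  simpa [coeff_homogeneousComponent] using hx

theorem le_of_mem_idealOfVars_pow {σ K : Type*} [CommRing K] {f : MvPolynomial σ K} {d k : ℕ}
    (hf : f ∈ idealOfVars σ K ^ k) (hf0 : f ≠ 0) (hd : f.IsHomogeneous d) : k ≤ d := by
  obtain ⟨x, hx⟩ := exists_coeff_ne_zero hf0
  have hxd : x.degree = d := by
    rw [Finsupp.degree_eq_weight_one]
    exact hd hx
  exact hxd ▸ (mem_pow_idealOfVars_iff k f).mp hf x (mem_support_iff.mpr hx)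

/-- In positive dimension every point lies on a hyperplane. -/
theorem exists_linear_form_mem_pointIdeal {K : Type*} [Field K] {N : ℕ} (hN : N ≠ 0)
    (q : ℙ K (Fin (N + 1) → K)) :
    ∃ f ∈ pointIdeal q, f ≠ 0 ∧ f.IsHomogeneous 1 := by
  have hne : Fin.last N ≠ 0 := by simpa [Fin.ext_iff] using hN
  by_cases h0 : q.rep 0 = 0
  · exact ⟨X 0, Ideal.subset_span ⟨⟨1, isHomogeneous_X _ _⟩, by simpa using h0⟩,
      X_ne_zero _, isHomogeneous_X _ _⟩
  · have hhom : (C (q.rep (Fin.last N)) * X 0 - C (q.rep 0) * X (Fin.last N) :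
        MvPolynomial (Fin (N + 1)) K).IsHomogeneous 1 :=
      (isHomogeneous_C_mul_X _ _).sub (isHomogeneous_C_mul_X _ _)
    refine ⟨_, Ideal.subset_span ⟨⟨1, hhom⟩, by simp; ring⟩, ?_, hhom⟩
    refine ne_zero_iff.mpr ⟨Finsupp.single (Fin.last N) 1, ?_⟩
    simpa [coeff_C_mul, coeff_X, Finsupp.single_left_inj, hne.symm] using h0

theorem exists_form_mem_iInf_pointIdeal_pow {K : Type*} [Field K] {N n : ℕ} (hN : N ≠ 0)
    (p : Fin n → ℙ K (Fin (N + 1) → K)) (m : ℕ) :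
    ∃ f ∈ ⨅ i, pointIdeal (p i) ^ m, f ≠ 0 ∧ f.IsHomogeneous (alphaDeg (⨅ i, pointIdeal (p i) ^ m))
    := by
  choose g hg hg0 hg1 using fun i => exists_linear_form_mem_pointIdeal hN (p i)
  have hne : {d : ℕ | ∃ f ∈ ⨅ i, pointIdeal (p i) ^ m, f ≠ 0 ∧ f.IsHomogeneous d}.Nonempty := by
    refine ⟨_, ∏ i, g i ^ m, ?_, Finset.prod_ne_zero_iff.mpr fun i _ => pow_ne_zero _ (hg0 i),
      IsHomogeneous.prod _ _ _ fun i _ => (hg1 i).pow m⟩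
    rw [Ideal.mem_iInf]
    exact fun i => Ideal.mem_of_dvd _ (Finset.dvd_prod_of_mem _ (Finset.mem_univ i))
      (Ideal.pow_mem_pow (hg i) m)
  exact Nat.sInf_mem hne

/-- if `I^(Nr) ⊆ M^{r(N-1)} I^r` for all `r ≥ 1`, then
`α(I^(m))/m ≥ (α(I)+N-1)/N` for all `m ≥ 1`. -/
theorem stmt4 {K : Type*} [Field K] {N n : ℕ} (hn : 0 < n)
    (p : Fin n → ℙ K (Fin (N + 1) → K)) (hinj : Function.Injective p)
    (hcont : ∀ r : ℕ, 1 ≤ r →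
      (⨅ i, (pointIdeal (p i)) ^ (N * r)) ≤
        (irrIdeal K N) ^ (r * (N - 1)) * (⨅ i, pointIdeal (p i)) ^ r) :
    ∀ m : ℕ, 1 ≤ m →
      (alphaDeg (⨅ i, (pointIdeal (p i)) ^ m) : ℚ) / m ≥
        ((alphaDeg (⨅ i, pointIdeal (p i)) : ℚ) + N - 1) / N := by
  intro m hm
  rcases Nat.eq_zero_or_pos N with rfl | hN
  · simp only [Nat.cast_zero, div_zero]
    positivity
  obtain ⟨f, hf, hf0, hfd⟩ := exists_form_mem_iInf_pointIdeal_pow hN.ne' p m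
  set d := alphaDeg (⨅ i, pointIdeal (p i) ^ m)
  set a := alphaDeg (⨅ i, pointIdeal (p i))
  have hfN : f ^ N ∈ ⨅ i, pointIdeal (p i) ^ (N * m) := by
    rw [Ideal.mem_iInf] at hf ⊢
    intro i
    rw [mul_comm, pow_mul]
    exact Ideal.pow_mem_pow (hf i) N
  have hI : (⨅ i, pointIdeal (p i)) ≤ idealOfVars (Fin (N + 1)) K ^ a :=
    le_idealOfVars_pow_alphaDeg
      (Ideal.IsHomogeneous.iInf fun i => isHomogeneous_pointIdeal (p i))
  have hmem : f ^ N ∈ idealOfVars (Fin (N + 1)) K ^ (m * (N - 1) + a * m) := by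
    rw [pow_add, pow_mul _ a m]
    exact Ideal.mul_mono le_rfl (Ideal.pow_right_mono hI m) (hcont m hm hfN)
  have hdeg : m * (N - 1) + a * m ≤ d * N :=
    le_of_mem_idealOfVars_pow hmem (pow_ne_zero _ hf0) (hfd.pow N)
  have hq : (m : ℚ) * (N - 1) + a * m ≤ d * N := by
    have := (Nat.cast_le (α := ℚ)).mpr hdeg
    push_cast [Nat.cast_sub hN] at this
    exact this
  rw [ge_iff_le, div_le_div_iff₀ (by exact_mod_cast hN) (by exact_mod_cast hm)]
  linarith

end
end
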